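/- arXiv:1805.10894 — 2 statements merged into one kernel-verified Lean document; each statement's English description precedes it below -/
import Mathlib

section
/- For every prime p there exist a group G, an integer n ≥ 1, and an element g ∈ G such that g lies in the n-th dimension subgroup δ_n(G), g does not lie in the n-th lower central term γ_n(G), and g^p lies in γ_n(G); in other words, the dimension quotient δ_n(G)/γ_n(G) contains an element of order p (a copy of ℤ/p). -/
/-- The augmentation ideal of the integral group ring `ℤG`: the kernel of the ring
homomorphism `ℤG → ℤ` sending each group element to `1`, viewed as a `ℤ`-submodule
(so that its powers make sense also for noncommutative group rings). -/
noncomputable def augIdeal (G : Type*) [Group G] : Submodule ℤ (MonoidAlgebra ℤ G) :=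
  Submodule.restrictScalars ℤ
    (RingHom.ker ((MonoidAlgebra.lift ℤ ℤ G) 1).toRingHom)

/-- The `n`-th dimension subgroup `δ_n(G) = {g ∈ G : g - 1 ∈ ϖ^n}`. -/
noncomputable def dimensionSubgroup (G : Type*) [Group G] (n : ℕ) : Set G :=
  {g : G | (MonoidAlgebra.of ℤ G g : MonoidAlgebra ℤ G) - 1 ∈ (augIdeal G) ^ n}

/-- `γ_n(G)`, the `n`-th term of the lower central series, with `γ_1(G) = G`. -/
def gammaGrp (G : Type*) [Group G] (n : ℕ) : Subgroup G := (⊤ : Subgroup G).lowerCentralSeries (n - 1)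

namespace DQ

section poly
variable {H : Type*} [Group H]

def stepD (t f : H) : Bool → H
  | true => t * f * t⁻¹ * f⁻¹
  | false => f⁻¹ * (t * f * t⁻¹)

def PSet (F : ℕ → Subgroup H) (t : H) (w : ℕ) : Set H :=
  {f | ∀ l : List Bool, l.foldl (stepD t) f ∈ F (w + l.length)}

lemma mem_PSet_iff (F : ℕ → Subgroup H) (t : H) (w : ℕ) (f : H) :
    f ∈ PSet F t w ↔ f ∈ F w ∧ t * f * t⁻¹ * f⁻¹ ∈ PSet F t (w + 1) ∧
      f⁻¹ * (t * f * t⁻¹) ∈ PSet F t (w + 1) := by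
  constructor
  · intro h
    refine ⟨by simpa using h [], fun l => ?_, fun l => ?_⟩
    · have := h (true :: l)
      simpa [stepD, add_assoc, add_comm 1] using this
    · have := h (false :: l)
      simpa [stepD, add_assoc, add_comm 1] using this
  · rintro ⟨h0, h1, h2⟩ l
    rcases l with _ | ⟨b, l⟩
    · simpa using h0
    · cases b
      · have := h2 l
        simpa [stepD, add_assoc, add_comm 1] using this
      · have := h1 l
        simpa [stepD, add_assoc, add_comm 1] using this

structure PData (F : ℕ → Subgroup H) (t : H) (n : ℕ) : Prop where
  anti : Antitone F
  comm : ∀ w v f g, f ∈ F w → g ∈ F v → f * g * f⁻¹ * g⁻¹ ∈ F (w + v)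
  tmem : ∀ w f, f ∈ F w → t * f * t⁻¹ ∈ F w
  tmem' : ∀ w f, f ∈ F w → t⁻¹ * f * t ∈ F w
  bot : F n = ⊥

variable {F : ℕ → Subgroup H} {t : H} {n : ℕ}

lemma PData.one_mem (_h : PData F t n) (w : ℕ) : (1 : H) ∈ PSet F t w := by
  intro l
  have : l.foldl (stepD t) 1 = 1 := by
    induction l with
    | nil => rfl
    | cons b l ih => cases b <;> simpa [stepD] using ih
  rw [this]; exact (F _).one_mem

lemma PData.eq_one (h : PData F t n) {w : ℕ} (hw : n ≤ w) {f : H} (hf : f ∈ F w) : f = 1 := by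
  have := h.anti hw hf
  rwa [h.bot, Subgroup.mem_bot] at this

lemma PSet_sub {w : ℕ} {f : H} (hf : f ∈ PSet F t w) : f ∈ F w :=
  ((mem_PSet_iff F t w f).1 hf).1

lemma PData.anti' (h : PData F t n) {w v : ℕ} (hwv : w ≤ v) {f : H} (hf : f ∈ PSet F t v) :
    f ∈ PSet F t w := fun l => h.anti (by omega) (hf l)

lemma PData.inv (h : PData F t n) : ∀ (k w : ℕ), n ≤ w + k → ∀ f ∈ PSet F t w,
    f⁻¹ ∈ PSet F t w := by
  intro k
  induction k with
  | zero =>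
    intro w hw f hf
    have := h.eq_one (by omega) (PSet_sub hf)
    subst this; simpa using hf
  | succ k ih =>
    intro w hw f hf
    obtain ⟨h0, h1, h2⟩ := (mem_PSet_iff F t w f).1 hf
    rw [mem_PSet_iff]
    refine ⟨inv_mem h0, ?_, ?_⟩
    · convert ih (w+1) (by omega) _ h2 using 1
      group
    · convert ih (w+1) (by omega) _ h1 using 1
      group

lemma PData.inv' (h : PData F t n) {w : ℕ} {f : H} (hf : f ∈ PSet F t w) :
    f⁻¹ ∈ PSet F t w := h.inv n w (by omega) f hf

lemma PData.tinv (h : PData F t n) : ∀ (k w : ℕ), n ≤ w + k → ∀ f ∈ PSet F t w,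
    t * f * t⁻¹ ∈ PSet F t w ∧ t⁻¹ * f * t ∈ PSet F t w := by
  intro k
  induction k with
  | zero =>
    intro w hw f hf
    have := h.eq_one (by omega) (PSet_sub hf)
    subst this; simpa using hf
  | succ k ih =>
    intro w hw f hf
    obtain ⟨h0, h1, h2⟩ := (mem_PSet_iff F t w f).1 hf
    refine ⟨(mem_PSet_iff F t w _).2 ⟨h.tmem _ _ h0, ?_, ?_⟩,
      (mem_PSet_iff F t w _).2 ⟨h.tmem' _ _ h0, ?_, ?_⟩⟩
    · convert (ih (w+1) (by omega) _ h1).1 using 1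
      group
    · convert (ih (w+1) (by omega) _ h2).1 using 1
      group
    · convert (ih (w+1) (by omega) _ h1).2 using 1
      group
    · convert (ih (w+1) (by omega) _ h2).2 using 1
      group

lemma PData.mul_aux (h : PData F t n) (k : ℕ)
    (B : ∀ w v, n ≤ w + v + k → ∀ f ∈ PSet F t w, ∀ g ∈ PSet F t v,
      f * g * f⁻¹ * g⁻¹ ∈ PSet F t (w + v)) :
    ∀ (j w : ℕ), n ≤ w + j → n ≤ w + k + 1 + w → ∀ f ∈ PSet F t w, ∀ g ∈ PSet F t w,
      f * g ∈ PSet F t w := by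
  intro j
  induction j with
  | zero =>
    intro w hw _ f hf g hg
    have := h.eq_one (by omega) (PSet_sub hf)
    subst this; simpa using hg
  | succ j ih =>
    intro w hw hk f hf g hg
    obtain ⟨h0, h1, h2⟩ := (mem_PSet_iff F t w f).1 hf
    obtain ⟨g0, g1, g2⟩ := (mem_PSet_iff F t w g).1 hg
    have M := ih (w + 1) (by omega) (by omega)
    rw [mem_PSet_iff]
    refine ⟨mul_mem h0 g0, ?_, ?_⟩
    · have c1 := h.anti' (show w + 1 ≤ w + (w + 1) by omega)
        (B w (w+1) (by omega) f hf _ g1)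
      convert M _ h1 _ (M _ c1 _ g1) using 1
      group
    · have c1 := h.anti' (show w + 1 ≤ w + (w + 1) by omega)
        (B w (w+1) (by omega) g⁻¹ (h.inv' hg) _ h2)
      convert M _ (M _ c1 _ h2) _ g2 using 1
      group

lemma PData.commP (h : PData F t n) : ∀ (k w v : ℕ), n ≤ w + v + k →
    ∀ f ∈ PSet F t w, ∀ g ∈ PSet F t v, f * g * f⁻¹ * g⁻¹ ∈ PSet F t (w + v) := by
  intro k
  induction k with
  | zero =>
    intro w v hw f hf g hg
    have := h.eq_one (by omega) (h.comm w v f g (PSet_sub hf) (PSet_sub hg))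
    rw [this]; exact h.one_mem _
  | succ k ih =>
    intro w v hw f hf g hg
    have M := h.mul_aux k ih n (w + v + 1) (by omega) (by omega)
    -- conjugation
    have C : ∀ u, ∀ a ∈ PSet F t u, ∀ y ∈ PSet F t (w + v + 1),
        a * y * a⁻¹ ∈ PSet F t (w + v + 1) := by
      intro u a ha y hy
      have := h.anti' (show w + v + 1 ≤ u + (w + v + 1) by omega)
        (ih u (w+v+1) (by omega) a ha y hy)
      convert M _ this _ hy using 1
      group
    have Ct := fun y hy => h.tinv n (w+v+1) (by omega) y hy
    have hf' := h.inv' hf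
    have hg' := h.inv' hg
    have X1 : g⁻¹ * (t * g * t⁻¹) ∈ PSet F t (v + 1) := ((mem_PSet_iff F t v _).1 hg).2.2
    have X2 : t⁻¹ * (f⁻¹ * (t * f * t⁻¹)) * t ∈ PSet F t (w + 1) :=
      (h.tinv n (w+1) (by omega) _ ((mem_PSet_iff F t w _).1 hf).2.2).2
    have Y1 := ih (v+1) w (by omega) _ X1 f⁻¹ hf'
    have Y2 := ih (w+1) v (by omega) _ X2 g hg
    rw [show v + 1 + w = w + v + 1 by omega] at Y1
    rw [show w + 1 + v = w + v + 1 by omega] at Y2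
    have Dm : t * (f * g * f⁻¹ * g⁻¹) * t⁻¹ * (f * g * f⁻¹ * g⁻¹)⁻¹ ∈ PSet F t (w + v + 1) := by
      have Z := C w f hf _ (M _ (Ct _ Y2).1 _ (C v g hg _ Y1))
      convert Z using 1
      group
    rw [mem_PSet_iff]
    refine ⟨h.comm w v f g (PSet_sub hf) (PSet_sub hg), Dm, ?_⟩
    have e1 := C v g hg _ (C w f hf _ (C v _ hg' _ (C w _ hf' _ Dm)))
    convert e1 using 1
    group

lemma PData.mulP (h : PData F t n) {w : ℕ} {f g : H} (hf : f ∈ PSet F t w)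
    (hg : g ∈ PSet F t w) : f * g ∈ PSet F t w :=
  h.mul_aux n (h.commP n) n w (by omega) (by omega) f hf g hg

def PSub (h : PData F t n) (w : ℕ) : Subgroup H where
  carrier := PSet F t w
  mul_mem' := h.mulP
  one_mem' := h.one_mem w
  inv_mem' := h.inv'

lemma mem_PSub (h : PData F t n) {w : ℕ} {f : H} : f ∈ PSub h w ↔ f ∈ PSet F t w := Iff.rfl

lemma PSub_comm (h : PData F t n) {w v : ℕ} {f g : H} (hf : f ∈ PSub h w) (hg : g ∈ PSub h v) :
    f * g * f⁻¹ * g⁻¹ ∈ PSub h (w + v) := h.commP n w v (by omega) f hf g hg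

lemma PSub_t (h : PData F t n) {w : ℕ} {f : H} (hf : f ∈ PSub h w) :
    f * t * f⁻¹ * t⁻¹ ∈ PSub h (w + 1) := by
  have := (PSub h (w+1)).inv_mem (x := t * f * t⁻¹ * f⁻¹) ((mem_PSet_iff F t w f).1 hf).2.1
  convert this using 1
  group

lemma PSub_le (h : PData F t n) {w v : ℕ} (hwv : w ≤ v) : PSub h v ≤ PSub h w :=
  fun _ hf => h.anti' hwv hf

lemma PSub_conj (h : PData F t n) {w : ℕ} {f : H} (hf : f ∈ PSub h w) :
    t * f * t⁻¹ ∈ PSub h w ∧ t⁻¹ * f * t ∈ PSub h w := h.tinv n w (by omega) f hf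
end poly
end DQ

namespace DQ
section polyG
variable {H : Type} [Group H] {F : ℕ → Subgroup H} {t : H} {n : ℕ}

def KG (h : PData F t n) : Subgroup H := Subgroup.closure ((PSub h 1 : Set H) ∪ {t})

lemma KG_comm (h : PData F t n) {k : H} (hk : k ∈ KG h) : ∀ w : ℕ, ∀ f ∈ PSub h w,
    f * k * f⁻¹ * k⁻¹ ∈ PSub h (w + 1) := by
  unfold KG at hk
  induction hk using Subgroup.closure_induction'' with
  | mem x hx =>
    intro w f hf
    rcases hx with hx | hx
    · exact PSub_comm h hf hx
    · rw [Set.mem_singleton_iff] at hx; subst hx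
      exact PSub_t h hf
  | inv_mem x hx =>
    intro w f hf
    rcases hx with hx | hx
    · exact PSub_comm h hf (inv_mem hx)
    · rw [Set.mem_singleton_iff] at hx; subst hx
      have := (PSub_conj h (inv_mem (PSub_t h hf))).2
      convert this using 1
      group
  | one => intro w f hf; simp
  | mul x y _ _ hx hy =>
    intro w f hf
    have h1 := hx w f hf
    have h2 := hy w f hf
    have h3 := PSub_le h (Nat.le_succ (w+1)) (inv_mem (hx _ _ h2))
    convert mul_mem h1 (mul_mem h3 h2) using 1
    group

lemma KG_conj (h : PData F t n) {k : H} (hk : k ∈ KG h) {w : ℕ} {f : H} (hf : f ∈ PSub h w) :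
    k * f * k⁻¹ ∈ PSub h w := by
  have := PSub_le h (Nat.le_succ w) (inv_mem (KG_comm h hk w f hf))
  convert mul_mem this hf using 1
  group

lemma KG_conj' (h : PData F t n) {k : H} (hk : k ∈ KG h) {w : ℕ} {f : H} (hf : f ∈ PSub h w) :
    k⁻¹ * f * k ∈ PSub h w := by
  simpa using KG_conj h (inv_mem hk) hf

lemma KG_comm2 (h : PData F t n) {k l : H} (hk : k ∈ KG h) (hl : l ∈ KG h) :
    k * l * k⁻¹ * l⁻¹ ∈ PSub h 2 := by
  have T : ∀ l ∈ KG h, t * l * t⁻¹ * l⁻¹ ∈ PSub h 2 := by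
    intro l hl
    unfold KG at hl
    induction hl using Subgroup.closure_induction with
    | mem x hx =>
      rcases hx with hx | hx
      · convert inv_mem (PSub_t h hx) using 1
        group
      · rw [Set.mem_singleton_iff] at hx; subst hx
        simp
    | one => simp
    | mul x y hx _ h1 h2 =>
      convert mul_mem h1 (KG_conj h hx h2) using 1
      group
    | inv x hx h1 =>
      convert KG_conj' h hx (inv_mem h1) using 1
      group
  unfold KG at hk
  induction hk using Subgroup.closure_induction with
  | mem x hx =>
    rcases hx with hx | hx
    · exact KG_comm h hl 1 x hx
    · rw [Set.mem_singleton_iff] at hx; subst hx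
      exact T l hl
  | one => simp
  | mul x y hx _ h1 h2 =>
    convert mul_mem (KG_conj h hx h2) h1 using 1
    group
  | inv x hx h1 =>
    convert KG_conj' h hx (inv_mem h1) using 1
    group

lemma KG_lcs (h : PData F t n) (w : ℕ) :
    (⊤ : Subgroup (KG h)).lowerCentralSeries (w + 1) ≤ (PSub h (w + 2)).comap (KG h).subtype := by
  induction w with
  | zero =>
    rw [Subgroup.lowerCentralSeries_succ, Subgroup.commutator_le]
    intro x _ y _
    exact KG_comm2 h x.2 y.2
  | succ w ih =>
    rw [Subgroup.lowerCentralSeries_succ, Subgroup.commutator_le]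
    intro x hx y _
    exact KG_comm h y.2 _ _ (ih hx)

lemma KG_bot (h : PData F t n) (hn : 2 ≤ n) : gammaGrp (KG h) n = ⊥ := by
  rw [eq_bot_iff]
  intro x hx
  obtain ⟨m, rfl⟩ : ∃ m, n = m + 2 := ⟨n - 2, by omega⟩
  have := KG_lcs h m hx
  rw [Subgroup.mem_bot]
  exact Subtype.ext (h.eq_one le_rfl (PSet_sub this))

end polyG

section wreath
variable {Γ : Type} [Group Γ]

def shiftA (Γ : Type) [Group Γ] : MulAut (ℤ → Γ) where
  toFun f := fun i => f (i + 1)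
  invFun f := fun i => f (i - 1)
  left_inv f := by funext i; simp
  right_inv f := by funext i; simp
  map_mul' f g := rfl

abbrev WH (Γ : Type) [Group Γ] := (ℤ → Γ) ⋊[zpowersHom (MulAut (ℤ → Γ)) (shiftA Γ)] Multiplicative ℤ

def tt : WH Γ := SemidirectProduct.inr (Multiplicative.ofAdd 1)

lemma tt_conj (f : ℤ → Γ) : (tt : WH Γ) * SemidirectProduct.inl f * tt⁻¹ =
    SemidirectProduct.inl (fun i => f (i + 1)) := by
  rw [tt, ← map_inv, ← SemidirectProduct.inl_aut]
  simp [shiftA]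

lemma tt_conj' (f : ℤ → Γ) : (tt : WH Γ)⁻¹ * SemidirectProduct.inl f * tt =
    SemidirectProduct.inl (fun i => f (i - 1)) := by
  have := tt_conj (fun i => f (i - 1))
  simp only [add_sub_cancel_right] at this
  rw [← this]; group

def FW (E : ℕ → Subgroup Γ) (w : ℕ) : Subgroup (WH Γ) :=
  (Subgroup.pi Set.univ (fun _ => E w)).map SemidirectProduct.inl

lemma mem_FW {E : ℕ → Subgroup Γ} {w : ℕ} {z : WH Γ} : z ∈ FW E w ↔
    ∃ f : ℤ → Γ, (∀ i, f i ∈ E w) ∧ SemidirectProduct.inl f = z := by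
  simp [FW, Subgroup.mem_map, Subgroup.mem_pi]

lemma FW_data (E : ℕ → Subgroup Γ) (n : ℕ) (anti : Antitone E)
    (comm : ∀ w v f g, f ∈ E w → g ∈ E v → f * g * f⁻¹ * g⁻¹ ∈ E (w + v)) (bot : E n = ⊥) :
    PData (FW E) tt n where
  anti := by
    intro w v hwv z hz
    obtain ⟨f, hf, rfl⟩ := mem_FW.1 hz
    exact mem_FW.2 ⟨f, fun i => anti hwv (hf i), rfl⟩
  comm := by
    intro w v f g hf hg
    obtain ⟨f, hf', rfl⟩ := mem_FW.1 hf
    obtain ⟨g, hg', rfl⟩ := mem_FW.1 hg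
    exact mem_FW.2 ⟨f * g * f⁻¹ * g⁻¹, fun i => comm _ _ _ _ (hf' i) (hg' i), by simp⟩
  tmem := by
    intro w f hf
    obtain ⟨f, hf', rfl⟩ := mem_FW.1 hf
    exact mem_FW.2 ⟨_, fun i => hf' (i+1), (tt_conj f).symm⟩
  tmem' := by
    intro w f hf
    obtain ⟨f, hf', rfl⟩ := mem_FW.1 hf
    exact mem_FW.2 ⟨_, fun i => hf' (i-1), (tt_conj' f).symm⟩
  bot := by
    rw [eq_bot_iff]
    intro z hz
    obtain ⟨f, hf, rfl⟩ := mem_FW.1 hz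
    have : f = 1 := by
      funext i
      have := hf i
      rwa [bot, Subgroup.mem_bot] at this
    rw [this, map_one]; exact one_mem _

def binf (x : Γ) (j : ℕ) : WH Γ := SemidirectProduct.inl (fun i : ℤ => x ^ (Ring.choose i j))

lemma binf_step (x : Γ) (j : ℕ) : tt * binf x (j+1) * tt⁻¹ = binf x j * binf x (j+1) := by
  rw [binf, tt_conj, binf, ← map_mul]
  congr 1
  funext i
  rw [Pi.mul_apply, ← zpow_add, Ring.choose_succ_succ]

lemma binf_comm (x : Γ) (j k : ℕ) : binf x j * binf x k = binf x k * binf x j := by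
  rw [binf, binf, ← map_mul, ← map_mul]
  congr 1
  funext i
  simp only [Pi.mul_apply, ← zpow_add, add_comm]

lemma binf_zero (x : Γ) : tt * binf x 0 * tt⁻¹ = binf x 0 := by
  rw [binf, tt_conj]; simp

lemma binf_mem (E : ℕ → Subgroup Γ) (n : ℕ) (D : PData (FW E) tt n) (anti : Antitone E) (x : Γ)
    (j : ℕ) : ∀ w, x ∈ E (w + j) → binf x j ∈ PSub D w := by
  induction j with
  | zero =>
    intro w hx
    rw [mem_PSub, mem_PSet_iff, binf_zero]
    refine ⟨mem_FW.2 ⟨_, fun i => zpow_mem hx _, rfl⟩, ?_, ?_⟩ <;> simp [D.one_mem]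
  | succ j ih =>
    intro w hx
    have h1 := ih (w + 1) (by rwa [show w + 1 + j = w + (j+1) by omega])
    rw [mem_PSub, mem_PSet_iff, binf_step]
    refine ⟨mem_FW.2 ⟨_, fun i => zpow_mem (anti (by omega) hx) _, rfl⟩, ?_, ?_⟩
    · rw [mul_inv_cancel_right]; exact h1
    · rw [binf_comm, inv_mul_cancel_left]; exact h1

lemma lcs_chain {G : Type} [Group G] (t : G) (f : ℕ → G) (m : ℕ)
    (h : ∀ j, j < m → t * f (j+1) * t⁻¹ * (f (j+1))⁻¹ = f j) :
    ∀ i, i ≤ m → f (m - i) ∈ (⊤ : Subgroup G).lowerCentralSeries i := by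
  intro i
  induction i with
  | zero => intro _; simp
  | succ i ih =>
    intro hi
    have h1 := ih (by omega)
    have h2 := h (m - (i+1)) (by omega)
    rw [show m - (i+1) + 1 = m - i by omega] at h2
    rw [Subgroup.lowerCentralSeries_succ, ← h2]
    have := inv_mem (Subgroup.commutator_mem_commutator h1 (Subgroup.mem_top t))
    convert this using 1
    rw [commutatorElement_def]
    group

theorem exists_group (E : ℕ → Subgroup Γ) (n : ℕ) (hn : 2 ≤ n) (anti : Antitone E)
    (comm : ∀ w v f g, f ∈ E w → g ∈ E v → f * g * f⁻¹ * g⁻¹ ∈ E (w + v)) (bot : E n = ⊥) :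
    ∃ (G : Type) (_ : Group G) (ι : E 1 →* G), Function.Injective ι ∧
      (∀ w, 1 ≤ w → ∀ x : E 1, (x : Γ) ∈ E w → ι x ∈ gammaGrp G w) ∧ gammaGrp G n = ⊥ := by
  have D := FW_data E n anti comm bot
  have hK : ∀ x : Γ, x ∈ E 1 → binf x 0 ∈ KG D := fun x hx =>
    Subgroup.subset_closure (Or.inl (binf_mem E n D anti x 0 1 (by simpa using hx)))
  let ι0 : E 1 →* WH Γ :=
    { toFun := fun x => binf (x : Γ) 0
      map_one' := by
        simp only [binf, OneMemClass.coe_one, one_zpow]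
        exact map_one SemidirectProduct.inl
      map_mul' := by
        intro x y
        simp only [binf, Ring.choose_zero_right, zpow_one]
        rw [← map_mul]; rfl }
  refine ⟨KG D, inferInstance, ι0.codRestrict (KG D) (fun x => hK x x.2), ?_, ?_, KG_bot D hn⟩
  · intro x y hxy
    have h1 : binf (x : Γ) 0 = binf (y : Γ) 0 := congrArg Subtype.val hxy
    have h2 := congrFun (SemidirectProduct.inl_injective h1) 0
    simpa using h2
  · intro w hw x hx
    obtain ⟨m, rfl⟩ : ∃ m, w = m + 1 := ⟨w - 1, by omega⟩
    have hin : ∀ j, j ≤ m → binf (x : Γ) j ∈ KG D := fun j hj =>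
      Subgroup.subset_closure (Or.inl (binf_mem E n D anti x j 1 (anti (by omega) hx)))
    have ht : (tt : WH Γ) ∈ KG D := Subgroup.subset_closure (Or.inr rfl)
    let f : ℕ → KG D := fun j => if hj : j ≤ m then ⟨binf (x : Γ) j, hin j hj⟩ else 1
    have := lcs_chain (⟨tt, ht⟩ : KG D) f m (by
      intro j hj
      apply Subtype.ext
      simp only [f, dif_pos hj.le, dif_pos (Nat.succ_le_of_lt hj)]
      simp only [Subgroup.coe_mul, Subgroup.coe_inv]
      rw [binf_step]; simp) m le_rfl
    simp only [f, Nat.sub_self, Nat.zero_le, dif_pos] at this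
    exact this
end wreath
end DQ

namespace DQ
section affine

@[ext] structure Aff (S : Type) [CommRing S] where
  u : Sˣ
  f : S

variable {S : Type} [CommRing S]

instance : Mul (Aff S) := ⟨fun a b => ⟨a.u * b.u, a.f + a.u * b.f⟩⟩
instance : One (Aff S) := ⟨⟨1, 0⟩⟩
instance : Inv (Aff S) := ⟨fun a => ⟨a.u⁻¹, -((a.u⁻¹ : Sˣ) : S) * a.f⟩⟩

@[simp] lemma Aff.mul_u (a b : Aff S) : (a * b).u = a.u * b.u := rfl
@[simp] lemma Aff.mul_f (a b : Aff S) : (a * b).f = a.f + a.u * b.f := rfl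
@[simp] lemma Aff.one_u : (1 : Aff S).u = 1 := rfl
@[simp] lemma Aff.one_f : (1 : Aff S).f = 0 := rfl
@[simp] lemma Aff.inv_u (a : Aff S) : (a⁻¹).u = a.u⁻¹ := rfl
@[simp] lemma Aff.inv_f (a : Aff S) : (a⁻¹).f = -((a.u⁻¹ : Sˣ) : S) * a.f := rfl

instance : Group (Aff S) :=
  Group.ofLeftAxioms
    (by intro a b c; ext <;> simp [mul_assoc]; ring)
    (by intro a; ext <;> simp)
    (by intro a; ext <;> simp)

lemma Aff.comm (a b : Aff S) : a * b * a⁻¹ * b⁻¹ =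
    ⟨1, ((a.u : S) - 1) * b.f - ((b.u : S) - 1) * a.f⟩ := by
  rw [mul_inv_eq_iff_eq_mul, mul_inv_eq_iff_eq_mul]
  ext
  · simp [mul_comm]
  · simp; ring

lemma Aff.pow_u (a : Aff S) (m : ℕ) : (a ^ m).u = a.u ^ m := by
  induction m with
  | zero => simp
  | succ m ih => simp [pow_succ, ih]

lemma Aff.pow_f (a : Aff S) (m : ℕ) : (a ^ m).f = a.f * ∑ j ∈ Finset.range m, (a.u : S) ^ j := by
  induction m with
  | zero => simp
  | succ m ih => rw [pow_succ, Finset.sum_range_succ, Aff.mul_f, ih, Aff.pow_u]; push_cast; ring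

/-- combinatorial data -/
structure LData (S : Type) [CommRing S] where
  x : S
  P : S
  Λ : Type
  wt : Λ → ℕ
  e : Λ → ℕ
  dir : Λ → ℕ
  D : ℕ → S → S → Prop
  X0 : Λ
  hX0 : e X0 = 0 ∧ dir X0 = 0
  Dx : ∀ s r, D s (x * r) 0
  det : ∀ s, 1 ≤ s → ∀ k c k' c', D s k c → D s k' c' →
    k * c' - k' * c ∈ Ideal.span ({P, x} : Set S)

namespace LData
variable (d : LData S)

def M (w : ℕ) : AddSubgroup (S × S) :=
  AddSubgroup.closure {z | ∃ l : d.Λ, ∃ k c : S, w ≤ d.wt l ∧ d.D (d.dir l) k c ∧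
    z = (d.P ^ d.e l * k, d.P ^ d.e l * c)}

def Good (w : ℕ) (W : Multiset d.Λ) (C : ℕ) : Prop :=
  2 ≤ Multiset.card W ∧ w ≤ (W.map d.wt).sum ∧ (W.map d.e).sum ≤ C ∧
    ((∃ s, 1 ≤ s ∧ ∀ l ∈ W, d.dir l = s) → (W.map d.e).sum + 1 ≤ C)

def J (w : ℕ) : Ideal S :=
  Ideal.span {z | ∃ W C, d.Good w W C ∧ z = d.P ^ C * d.x ^ (Multiset.card W - 1)}

lemma M_anti {w v : ℕ} (h : w ≤ v) : d.M v ≤ d.M w := by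
  refine AddSubgroup.closure_mono ?_
  rintro z ⟨l, k, c, h1, h2, h3⟩
  exact ⟨l, k, c, h.trans h1, h2, h3⟩

lemma J_anti {w v : ℕ} (h : w ≤ v) : d.J v ≤ d.J w := by
  refine Ideal.span_mono ?_
  rintro z ⟨W, C, ⟨h1, h2, h3⟩, h4⟩
  exact ⟨W, C, ⟨h1, h.trans h2, h3⟩, h4⟩

lemma J_mem {w : ℕ} {W : Multiset d.Λ} {C : ℕ} (h : d.Good w W C) (m : ℕ)
    (hm : Multiset.card W = m + 1) (r : S) : d.P ^ C * d.x ^ m * r ∈ d.J w := by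
  refine Ideal.mul_mem_right _ _ (Ideal.subset_span ⟨W, C, h, ?_⟩)
  rw [hm, Nat.add_sub_cancel]

lemma pairX (l : d.Λ) (w : ℕ) (h : w ≤ d.wt l) : d.Good w {l, d.X0} (d.e l) := by
  refine ⟨by simp, ?_, ?_, ?_⟩
  · simp; omega
  · simp [d.hX0.1]
  · rintro ⟨s, hs, h⟩
    have := h d.X0 (by simp)
    rw [d.hX0.2] at this; omega

lemma lemA {w : ℕ} {z : S × S} (hz : z ∈ d.M w) (r : S) :
    (d.x * z.1 * r, (0 : S)) ∈ d.M w ∧ d.x * z.1 * r ∈ d.J w := by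
  induction hz using AddSubgroup.closure_induction with
  | mem z hz =>
    obtain ⟨l, k, c, h1, h2, rfl⟩ := hz
    constructor
    · refine AddSubgroup.subset_closure ⟨l, d.x * (k * r), 0, h1, d.Dx _ _, ?_⟩
      ext <;> simp; ring
    · have := d.J_mem (d.pairX l w h1) 1 (by simp) (k * r)
      convert this using 1
      simp; ring
  | zero =>
    simp only [Prod.fst_zero, mul_zero, zero_mul]
    exact ⟨zero_mem _, zero_mem _⟩
  | add y z _ _ hy hz =>
    constructor
    · convert add_mem hy.1 hz.1 using 1
      ext <;> simp; ring
    · convert add_mem hy.2 hz.2 using 1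
      simp; ring
  | neg z _ hz =>
    constructor
    · convert neg_mem hz.1 using 1
      ext <;> simp
    · convert neg_mem hz.2 using 1
      simp

lemma lemB {w v : ℕ} {z : S × S} (hz : z ∈ d.M w) {j : S} (hj : j ∈ d.J v) :
    d.x * z.1 * j ∈ d.J (w + v) := by
  induction hz using AddSubgroup.closure_induction with
  | mem z hz =>
    obtain ⟨l, k, c, h1, h2, rfl⟩ := hz
    refine Submodule.span_induction (p := fun j _ => d.x * (d.P ^ d.e l * k) * j ∈ d.J (w+v))
      ?_ ?_ ?_ ?_ hj
    · rintro j ⟨W, C, ⟨g1, g2, g3, g4⟩, rfl⟩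
      have : d.Good (w+v) (l ::ₘ W) (d.e l + C) := by
        refine ⟨by simp; omega, by simp; omega, by simp; omega, ?_⟩
        rintro ⟨s, hs, h⟩
        have := g4 ⟨s, hs, fun l hl => h l (by simp [hl])⟩
        simp; omega
      have := d.J_mem this (Multiset.card W) (by simp) k
      convert this using 1
      obtain ⟨m, hm⟩ : ∃ m, Multiset.card W = m + 1 := ⟨Multiset.card W - 1, by omega⟩
      rw [hm, Nat.add_sub_cancel]; ring
    · simp
    · intro a b _ _ ha hb
      rw [mul_add]; exact add_mem ha hb
    · intro a b _ hb
      rw [smul_eq_mul, mul_left_comm]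
      exact Ideal.mul_mem_left _ _ hb
  | zero => simp
  | add y z _ _ hy hz => convert add_mem hy hz using 1; simp; ring
  | neg z _ hz => convert neg_mem hz using 1; simp

lemma lemC {w v : ℕ} {y z : S × S} (hy : y ∈ d.M w) (hz : z ∈ d.M v) :
    d.x * (y.1 * z.2 - z.1 * y.2) ∈ d.J (w + v) := by
  induction hy using AddSubgroup.closure_induction with
  | zero => simp
  | add y z _ _ hy hz => convert add_mem hy hz using 1; simp; ring
  | neg z _ hz => convert neg_mem hz using 1; simp; ring
  | mem y hy =>
  induction hz using AddSubgroup.closure_induction with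
  | zero => simp
  | add y z _ _ hy hz => convert add_mem hy hz using 1; simp; ring
  | neg z _ hz => convert neg_mem hz using 1; simp; ring
  | mem z hz =>
  obtain ⟨l, k, c, h1, h2, rfl⟩ := hy
  obtain ⟨l', k', c', h1', h2', rfl⟩ := hz
  by_cases hd : 1 ≤ d.dir l ∧ d.dir l = d.dir l'
  · rw [← hd.2] at h2'
    have hdet := d.det _ hd.1 _ _ _ _ h2 h2'
    rw [Ideal.mem_span_pair] at hdet
    obtain ⟨a, b, hab⟩ := hdet
    have g1 : d.Good (w+v) {l, l'} (d.e l + d.e l' + 1) := by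
      refine ⟨by simp, by simp; omega, by simp, fun _ => by simp⟩
    have g2 : d.Good (w+v) {l, l', d.X0} (d.e l + d.e l') := by
      refine ⟨by simp, by simp; omega, by simp [d.hX0.1], ?_⟩
      rintro ⟨s, hs, h⟩
      have := h d.X0 (by simp)
      rw [d.hX0.2] at this; omega
    have k1 := d.J_mem g1 1 (by simp) a
    have k2 := d.J_mem g2 2 (by simp) b
    convert add_mem k1 k2 using 1
    simp only
    linear_combination (- d.P ^ (d.e l + d.e l') * d.x) * hab
  · have g1 : d.Good (w+v) {l, l'} (d.e l + d.e l') := by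
      refine ⟨by simp, by simp; omega, by simp, ?_⟩
      rintro ⟨s, hs, h⟩
      have a1 := h l (by simp)
      have a2 := h l' (by simp)
      omega
    have k1 := d.J_mem g1 1 (by simp) (k * c' - k' * c)
    convert k1 using 1
    simp only; ring

def E (w : ℕ) : Subgroup (Aff S) where
  carrier := {a | ∃ z ∈ d.M w, (a.u : S) = 1 + d.x * z.1 ∧ a.f - z.2 ∈ d.J w}
  one_mem' := ⟨0, zero_mem _, by simp, by simp⟩
  mul_mem' := by
    rintro a b ⟨z, hz, hu, hf⟩ ⟨z', hz', hu', hf'⟩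
    have hA := d.lemA hz z'.1
    have hB := d.lemA hz b.f
    refine ⟨z + z' + (d.x * z.1 * z'.1, 0), add_mem (add_mem hz hz') hA.1, ?_, ?_⟩
    · simp [hu, hu']; ring
    · convert add_mem (add_mem hf hf') hB.2 using 1
      simp [hu]; ring
  inv_mem' := by
    rintro a ⟨z, hz, hu, hf⟩
    have hi : (a.u : S) * ((a.u⁻¹ : Sˣ) : S) = 1 := Units.mul_inv _
    rw [hu] at hi
    have hA := d.lemA hz (z.1 * ((a.u⁻¹ : Sˣ) : S))
    have hB := d.lemA hz (((a.u⁻¹ : Sˣ) : S) * a.f)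
    refine ⟨-z + (d.x * z.1 * (z.1 * ((a.u⁻¹ : Sˣ) : S)), 0), add_mem (neg_mem hz) hA.1, ?_, ?_⟩
    · simp only [Aff.inv_u, Prod.fst_add, Prod.fst_neg]
      linear_combination (1 - d.x * z.1) * hi
    · convert add_mem (neg_mem hf) hB.2 using 1
      simp only [Aff.inv_f, Prod.snd_add, Prod.snd_neg]
      linear_combination (-a.f) * hi

lemma mem_E {w : ℕ} {a : Aff S} : a ∈ d.E w ↔
    ∃ z ∈ d.M w, (a.u : S) = 1 + d.x * z.1 ∧ a.f - z.2 ∈ d.J w := Iff.rfl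

lemma E_anti : Antitone d.E := by
  rintro w v h a ⟨z, hz, hu, hf⟩
  exact ⟨z, d.M_anti h hz, hu, d.J_anti h hf⟩

lemma E_comm (w v : ℕ) (a b : Aff S) (ha : a ∈ d.E w) (hb : b ∈ d.E v) :
    a * b * a⁻¹ * b⁻¹ ∈ d.E (w + v) := by
  obtain ⟨z, hz, hu, hf⟩ := ha
  obtain ⟨z', hz', hu', hf'⟩ := hb
  rw [Aff.comm]
  refine ⟨0, zero_mem _, by simp, ?_⟩
  have h1 := d.lemC hz hz'
  have h2 := d.lemB hz hf'
  have h3 := d.lemB hz' hf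
  rw [add_comm v w] at h3
  convert sub_mem (add_mem h1 h2) h3 using 1
  simp [hu, hu']; ring

lemma E_bot (n : ℕ) (h1 : ∀ l, d.wt l < n)
    (h2 : ∀ W C, d.Good n W C → d.P ^ C * d.x ^ (Multiset.card W - 1) = 0) : d.E n = ⊥ := by
  have hM : d.M n = ⊥ := by
    rw [M, AddSubgroup.closure_eq_bot_iff]
    rintro z ⟨l, k, c, h, _⟩
    exact absurd (h1 l) (by omega)
  have hJ : d.J n = ⊥ := by
    rw [J, Ideal.span_eq_bot]
    rintro z ⟨W, C, hG, rfl⟩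
    exact h2 W C hG
  rw [eq_bot_iff]
  rintro a ⟨z, hz, hu, hf⟩
  rw [hM, AddSubgroup.mem_bot] at hz
  subst hz
  rw [hJ] at hf
  rw [Subgroup.mem_bot]
  ext
  · simpa using hu
  · simpa using hf

lemma E_full (hD : ∀ k c, d.D 0 k c) (w : ℕ) (hw : w ≤ d.wt d.X0) (a : Aff S) (k : S)
    (hk : (a.u : S) = 1 + d.x * k) : a ∈ d.E w := by
  refine ⟨(k, a.f), AddSubgroup.subset_closure ⟨d.X0, k, a.f, hw, ?_, ?_⟩, hk, by simp⟩
  · rw [d.hX0.2]; exact hD _ _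
  · simp [d.hX0.1]

lemma E_letter (l : d.Λ) (hw : d.wt l ≤ 2 * d.wt d.X0) (a : Aff S) (k c : S)
    (hD : d.D (d.dir l) k c) (h1 : (a.u : S) = 1 + d.x * (d.P ^ d.e l * k))
    (r : S) (h2 : a.f = d.P ^ d.e l * c + d.x * r) : a ∈ d.E (d.wt l) := by
  refine ⟨_, AddSubgroup.subset_closure ⟨l, k, c, le_rfl, hD, rfl⟩, h1, ?_⟩
  have g : d.Good (d.wt l) {d.X0, d.X0} 0 := by
    refine ⟨by simp, by simp; omega, by simp [d.hX0.1], ?_⟩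
    rintro ⟨s, hs, h⟩
    have := h d.X0 (by simp)
    rw [d.hX0.2] at this; omega
  have := d.J_mem g 1 (by simp) r
  convert this using 1
  simp [h2]

end LData
end affine
end DQ

namespace DQ
section ringpart
variable {A : Type} [Ring A]

structure Filt (L : ℕ → AddSubgroup A) : Prop where
  zero : L 0 = ⊤
  anti : Antitone L
  mul : ∀ {m l : ℕ} {x y : A}, x ∈ L m → y ∈ L l → x * y ∈ L (m + l)

variable {L : ℕ → AddSubgroup A}

lemma Filt.mulR (h : Filt L) {m : ℕ} {x : A} (y : A) (hx : x ∈ L m) : x * y ∈ L m := by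
  have := h.mul hx (show y ∈ L 0 by rw [h.zero]; trivial)
  simpa using this

lemma Filt.mulL (h : Filt L) {m : ℕ} {x : A} (y : A) (hx : x ∈ L m) : y * x ∈ L m := by
  have := h.mul (show y ∈ L 0 by rw [h.zero]; trivial) hx
  simpa using this

lemma Filt.pow (h : Filt L) {m : ℕ} {x : A} (hx : x ∈ L m) (k : ℕ) : x ^ k ∈ L (m * k) := by
  induction k with
  | zero => simp [h.zero]
  | succ k ih => rw [pow_succ, mul_add, mul_one]; exact h.mul ih hx

lemma Filt.upow (h : Filt L) {m : ℕ} {x : A} (hx : x - 1 ∈ L m) (k : ℕ) :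
    x ^ k - 1 ∈ L m ∧ x ^ k - 1 - (k : ℤ) • (x - 1) ∈ L (m + m) := by
  induction k with
  | zero => simp
  | succ k ih =>
    have h1 : x ^ (k+1) - 1 - ((k+1 : ℕ) : ℤ) • (x - 1) ∈ L (m + m) := by
      have : x ^ (k+1) - 1 - ((k+1 : ℕ) : ℤ) • (x - 1) =
        (x ^ k - 1 - (k : ℤ) • (x - 1)) + (x ^ k - 1) * (x - 1) := by
        push_cast
        rw [add_smul, one_smul]
        noncomm_ring
      rw [this]
      exact add_mem ih.2 (h.mul ih.1 hx)
    refine ⟨?_, h1⟩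
    have := add_mem (h.anti (Nat.le_add_right m m) h1) (zsmul_mem hx ((k+1 : ℕ) : ℤ))
    simpa using this

lemma Filt.comm (h : Filt L) {m l : ℕ} (x y : Aˣ) (hx : (x : A) - 1 ∈ L m) (hy : (y : A) - 1 ∈ L l)
    (hx1 : (x : A) - 1 ∈ L 1) (hy1 : (y : A) - 1 ∈ L 1) :
    ((x * y * x⁻¹ * y⁻¹ : Aˣ) : A) - 1 - (((x : A) - 1) * ((y : A) - 1) - ((y : A) - 1) * ((x : A) - 1))
      ∈ L (m + l + 1) := by
  have inv : ∀ z : Aˣ, (z : A) - 1 ∈ L 1 → ((z⁻¹ : Aˣ) : A) - 1 ∈ L 1 := by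
    intro z hz
    have : ((z⁻¹ : Aˣ) : A) - 1 = - (((z : A) - 1) * ((z⁻¹ : Aˣ) : A)) := by
      rw [sub_mul, Units.mul_inv]; simp
    rw [this]
    exact neg_mem (h.mulR _ hz)
  set d := (((x : A) - 1) * ((y : A) - 1) - ((y : A) - 1) * ((x : A) - 1)) with hd
  have hdm : d ∈ L (m + l) := sub_mem (h.mul hx hy) (by rw [add_comm]; exact h.mul hy hx)
  have hxy : ((x⁻¹ : Aˣ) : A) * ((y⁻¹ : Aˣ) : A) - 1 ∈ L 1 := by
    have e : ((x⁻¹ : Aˣ) : A) * ((y⁻¹ : Aˣ) : A) - 1 =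
      (((x⁻¹ : Aˣ) : A) - 1) * ((y⁻¹ : Aˣ) : A) + (((y⁻¹ : Aˣ) : A) - 1) := by noncomm_ring
    rw [e]
    exact add_mem (h.mulR _ (inv x hx1)) (inv y hy1)
  have key : ((x * y * x⁻¹ * y⁻¹ : Aˣ) : A) - 1 = d * (((x⁻¹ : Aˣ) : A) * ((y⁻¹ : Aˣ) : A)) := by
    have e : d = (x : A) * y - y * x := by rw [hd]; noncomm_ring
    rw [e, sub_mul]
    have e2 : (y : A) * x * (((x⁻¹ : Aˣ) : A) * ((y⁻¹ : Aˣ) : A)) = 1 := by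
      rw [mul_assoc, Units.mul_inv_cancel_left, Units.mul_inv]
    rw [e2]; push_cast; noncomm_ring
  rw [key]
  have : d * (((x⁻¹ : Aˣ) : A) * ((y⁻¹ : Aˣ) : A)) - d = d * (((x⁻¹ : Aˣ) : A) * ((y⁻¹ : Aˣ) : A) - 1) := by
    noncomm_ring
  rw [this]
  exact h.mul hdm hxy

/-- coefficients of `(U + iV)^m` -/
def sco (U V : A) : ℕ → ℕ → A
  | 0, 0 => 1
  | 0, _+1 => 0
  | m+1, 0 => sco U V m 0 * U
  | m+1, k+1 => sco U V m (k+1) * U + sco U V m k * V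

lemma sco_gt (U V : A) : ∀ m k, m < k → sco U V m k = 0 := by
  intro m
  induction m with
  | zero => intro k hk; obtain ⟨k, rfl⟩ : ∃ j, k = j+1 := ⟨k-1, by omega⟩; simp [sco]
  | succ m ih =>
    intro k hk; obtain ⟨k, rfl⟩ : ∃ j, k = j+1 := ⟨k-1, by omega⟩
    simp [sco, ih (k+1) (by omega), ih k (by omega)]

lemma sco_sum (U V : A) (i : ℤ) (m : ℕ) :
    (U + i • V) ^ m = ∑ k ∈ Finset.range (m+1), (i ^ k) • sco U V m k := by
  induction m with
  | zero => simp [sco]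
  | succ m ih =>
    rw [pow_succ, ih, Finset.sum_range_succ' _ (m+1), mul_add]
    have e1 : (∑ k ∈ Finset.range (m+1), (i ^ k) • sco U V m k) * U =
        (∑ k ∈ Finset.range (m+1), (i ^ (k+1)) • (sco U V m (k+1) * U)) + sco U V m 0 * U := by
      rw [Finset.sum_mul]
      rw [Finset.sum_range_succ' _ m, Finset.sum_range_succ _ m]
      simp [sco_gt U V m (m+1) (by omega), mul_assoc]
    have e2 : (∑ k ∈ Finset.range (m+1), (i ^ k) • sco U V m k) * (i • V) =
        (∑ k ∈ Finset.range (m+1), (i ^ (k+1)) • (sco U V m k * V)) := by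
      rw [Finset.sum_mul]
      refine Finset.sum_congr rfl fun k _ => ?_
      rw [smul_mul_assoc, mul_smul_comm, smul_smul, pow_succ]
    rw [e1, e2]
    simp only [sco, smul_add, Finset.sum_add_distrib, pow_zero, one_smul]
    abel

lemma sco_self (U V : A) (m : ℕ) : sco U V m m = V ^ m := by
  induction m with
  | zero => simp [sco]
  | succ m ih => simp [sco, sco_gt U V m (m+1) (by omega), ih, pow_succ]

lemma sco_pred (U V : A) (m : ℕ) : sco U V (m+1) m =
    ∑ j ∈ Finset.range (m+1), V ^ j * U * V ^ (m - j) := by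
  induction m with
  | zero => simp [sco]
  | succ m ih =>
    rw [sco, sco_self, ih, Finset.sum_range_succ _ (m+1), add_comm, Finset.sum_mul]
    congr 1
    · refine Finset.sum_congr rfl fun j hj => ?_
      rw [Finset.mem_range] at hj
      rw [mul_assoc, ← pow_succ, show m - j + 1 = m + 1 - j by omega]
    · simp

lemma sco_mem (h : Filt L) {U V : A} (hU : U ∈ L 1) (hV : V ∈ L 1) (Q : ℤ) (hQ : Q • U ∈ L 2) :
    ∀ m k, sco U V m k ∈ L m ∧ (k < m → Q • sco U V m k ∈ L (m+1)) := by
  intro m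
  induction m with
  | zero => intro k; simp [h.zero]
  | succ m ih =>
    intro k
    rcases k with _ | k
    · exact ⟨h.mul (ih 0).1 hU, fun _ => by
        rw [sco, ← mul_smul_comm]; exact (h.mul (ih 0).1 hQ : _ ∈ L (m+2))⟩
    · refine ⟨add_mem (h.mul (ih _).1 hU) (h.mul (ih _).1 hV), fun hk => ?_⟩
      rw [sco, smul_add, ← mul_smul_comm, ← smul_mul_assoc]
      exact add_mem (h.mul (ih _).1 hQ : _ ∈ L (m+2)) (h.mul ((ih k).2 (by omega)) hV)

lemma sum_pow_int (p : ℕ) (hp : p.Prime) (k : ℕ) (hk : k < p) :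
    ∃ μ : ℤ, ∑ i ∈ Finset.range p, (i : ℤ) ^ k = (if k = p - 1 then -1 else 0) + p * μ := by
  have : Fact p.Prime := ⟨hp⟩
  have e : ((∑ i ∈ Finset.range p, (i : ℤ) ^ k : ℤ) : ZMod p) = ∑ x : ZMod p, x ^ k := by
    push_cast
    refine Finset.sum_bij' (fun i _ => (i : ZMod p)) (fun x _ => x.val) ?_ ?_ ?_ ?_ ?_
    · simp
    · intro x _; simpa using ZMod.val_lt x
    · intro i hi; simpa using ZMod.val_cast_of_lt (Finset.mem_range.1 hi)
    · intro x _; simp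
    · simp
  have key : ((∑ i ∈ Finset.range p, (i : ℤ) ^ k - (if k = p - 1 then -1 else 0) : ℤ) : ZMod p) = 0 := by
    rw [Int.cast_sub, e]
    split_ifs with h
    · subst h
      have : ∀ x : ZMod p, x ^ (p - 1) = 1 - (if x = 0 then 1 else 0) := by
        intro x
        split_ifs with hx
        · subst hx
          have : p - 1 ≠ 0 := by have := hp.two_le; omega
          simp [this]
        · simp [ZMod.pow_card_sub_one_eq_one hx]
      simp [this]
    · rw [FiniteField.sum_pow_lt_card_sub_one]
      · simp
      · rw [ZMod.card]; omega
  rw [ZMod.intCast_zmod_eq_zero_iff_dvd] at key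
  obtain ⟨μ, hμ⟩ := key
  exact ⟨μ, by linarith⟩

lemma choose_mod (p : ℕ) (hp : p.Prime) (j : ℕ) (hj : j < p) :
    ∃ μ : ℤ, (-1) ^ j * ((p-1).choose j : ℤ) = 1 + p * μ := by
  induction j with
  | zero => exact ⟨0, by simp⟩
  | succ j ih =>
    obtain ⟨μ, hμ⟩ := ih (by omega)
    obtain ⟨ν, hν⟩ := hp.dvd_choose_self (Nat.succ_ne_zero j) hj
    have h1 : p.choose (j+1) = (p-1).choose j + (p-1).choose (j+1) := by
      conv_lhs => rw [show p = (p - 1) + 1 by omega]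
      rw [Nat.choose_succ_succ]
    have h2 : ((p-1).choose j : ℤ) + ((p-1).choose (j+1) : ℤ) = p * ν := by
      rw [← Nat.cast_add, ← h1, hν]; simp
    refine ⟨μ - (-1)^j * ν, ?_⟩
    rw [pow_succ]
    have : ((p-1).choose (j+1) : ℤ) = p * ν - ((p-1).choose j : ℤ) := by linarith
    rw [this]; linear_combination hμ

lemma ad_sum (U V : A) (k : ℕ) : (fun z => z * V - V * z)^[k] U =
    ∑ j ∈ Finset.range (k+1), ((-1) ^ j * (k.choose j : ℤ)) • (V ^ j * U * V ^ (k - j)) := by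
  have h1 : (fun z => z * V - V * z)^[k] U =
      ((-(LinearMap.mulLeft ℤ V) + LinearMap.mulRight ℤ V) ^ k) U := by
    rw [Module.End.pow_apply]
    congr 1
    funext z
    simp [sub_eq_neg_add]
  rw [h1, Commute.add_pow ((LinearMap.commute_mulLeft_right (R := ℤ) V V).neg_left)]
  rw [LinearMap.sum_apply]
  refine Finset.sum_congr rfl fun j _ => ?_
  rw [neg_pow, LinearMap.pow_mulLeft, LinearMap.pow_mulRight]
  have e1 : ((-1 : Module.End ℤ A) ^ j) = ((-1 : ℤ) ^ j) • 1 := by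
    rcases Nat.even_or_odd j with hj | hj <;> simp [hj.neg_one_pow]
  have e2 : ((k.choose j : Module.End ℤ A)) = (k.choose j : ℤ) • 1 := by simp
  rw [e1, e2]
  simp only [smul_mul_assoc, one_mul, mul_smul_comm, mul_one, LinearMap.smul_apply,
    Module.End.mul_apply, LinearMap.mulLeft_apply, LinearMap.mulRight_apply, smul_smul, mul_assoc]
  congr 1; ring

theorem ring_main (h : Filt L) (p : ℕ) (hp : p.Prime) (q : ℤ) (a b : Aˣ)
    (ha : (a : A) - 1 ∈ L 1) (hb : (b : A) - 1 ∈ L 1)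
    (H1 : ∀ i : ℕ, i < p → q • (((a : A) - 1) + (i : ℤ) • ((b : A) - 1)) ^ p ∈ L (p + 1))
    (H2 : q • ((b : A) - 1) ^ p ∈ L (p + 1))
    (H3 : ((p : ℤ) * q) • ((a : A) - 1) ∈ L 2) (Q : ℕ) (hQ : (Q : ℤ) = q) :
    (((fun z : Aˣ => z * b * z⁻¹ * b⁻¹)^[p-1] a ^ Q : Aˣ) : A) - 1 ∈ L (p + 1) := by
  set U := (a : A) - 1 with hU
  set V := (b : A) - 1 with hV
  have hp2 := hp.two_le
  have S := sco_mem h ha hb _ H3 p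
  -- q • s_{p-1}
  have h1 : q • sco U V p (p-1) ∈ L (p+1) := by
    have e1 : ∑ i ∈ Finset.range p, q • (U + (i : ℤ) • V) ^ p ∈ L (p+1) :=
      sum_mem fun i hi => H1 i (Finset.mem_range.1 hi)
    have e2 : ∑ i ∈ Finset.range p, q • (U + (i : ℤ) • V) ^ p =
      ∑ k ∈ Finset.range (p+1), (∑ i ∈ Finset.range p, (i : ℤ) ^ k) • (q • sco U V p k) := by
      simp only [sco_sum, Finset.smul_sum, Finset.sum_smul]
      rw [Finset.sum_comm]
      refine Finset.sum_congr rfl fun k _ => Finset.sum_congr rfl fun i _ => ?_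
      rw [smul_comm]
    rw [e2, Finset.sum_range_succ, sco_self] at e1
    have e3 := (AddSubgroup.add_mem_cancel_right _ (zsmul_mem H2 _)).1 e1
    rw [show Finset.range p = Finset.range (p - 1 + 1) by congr 1; omega, Finset.sum_range_succ,
      show p - 1 + 1 = p by omega] at e3
    have e4 : ∀ k, k < p → ∀ μ : ℤ, ((p : ℤ) * μ) • (q • sco U V p k) ∈ L (p+1) := by
      intro k hk μ
      have := zsmul_mem ((S k).2 hk) μ
      convert this using 1
      simp only [smul_smul]; congr 1; ring
    have e5 : ∑ k ∈ Finset.range (p-1), (∑ i ∈ Finset.range p, (i : ℤ) ^ k) • (q • sco U V p k)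
        ∈ L (p+1) := by
      refine sum_mem fun k hk => ?_
      rw [Finset.mem_range] at hk
      obtain ⟨μ, hμ⟩ := sum_pow_int p hp k (by omega)
      rw [hμ, if_neg (by omega), zero_add]
      exact e4 k (by omega) μ
    have e6 := (AddSubgroup.add_mem_cancel_left _ e5).1 e3
    obtain ⟨μ, hμ⟩ := sum_pow_int p hp (p-1) (by omega)
    rw [hμ, if_pos rfl, add_smul] at e6
    have e7 := (AddSubgroup.add_mem_cancel_right _ (e4 (p-1) (by omega) μ)).1 e6
    simpa using e7
  have h2 : q • ((fun z => z * V - V * z)^[p-1] U) ∈ L (p+1) := by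
    rw [ad_sum]
    have := sco_pred U V (p-1)
    rw [show p - 1 + 1 = p by omega] at this
    rw [this] at h1
    rw [show p - 1 + 1 = p by omega]
    rw [← AddSubgroup.add_mem_cancel_right _ (neg_mem h1), ← sub_eq_add_neg, ← smul_sub,
      ← Finset.sum_sub_distrib, Finset.smul_sum]
    refine sum_mem fun j hj => ?_
    rw [Finset.mem_range] at hj
    obtain ⟨μ, hμ⟩ := choose_mod p hp j hj
    rw [hμ, add_smul, one_smul, add_sub_cancel_left]
    have := h.mul (h.mul (h.pow hb j) H3) (h.pow hb (p - 1 - j))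
    have := zsmul_mem this μ
    rw [show 1 * j + 2 + 1 * (p - 1 - j) = p + 1 by omega] at this
    convert this using 1
    simp only [mul_smul_comm, smul_mul_assoc, smul_smul]
    congr 1; ring
  -- iterated commutators
  have h3 : ∀ k : ℕ, (((fun z : Aˣ => z * b * z⁻¹ * b⁻¹)^[k] a : Aˣ) : A) - 1 ∈ L (k+1) ∧
      (((fun z : Aˣ => z * b * z⁻¹ * b⁻¹)^[k] a : Aˣ) : A) - 1 - ((fun z => z * V - V * z)^[k] U)
        ∈ L (k+2) := by
    intro k
    induction k with
    | zero => exact ⟨ha, by simp [hU]⟩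
    | succ k ih =>
      rw [Function.iterate_succ_apply', Function.iterate_succ_apply']
      set c := (fun z : Aˣ => z * b * z⁻¹ * b⁻¹)^[k] a
      set z := (fun z => z * V - V * z)^[k] U
      have g1 := h.comm c b ih.1 hb (h.anti (by omega) ih.1) hb
      rw [← hV] at g1
      have g2 : ((c : A) - 1) * V - V * ((c : A) - 1) ∈ L (k + 1 + 1) :=
        sub_mem (h.mul ih.1 hb) (by rw [add_comm]; exact h.mul hb ih.1)
      have g3 : ((c : A) - 1 - z) * V - V * ((c : A) - 1 - z) ∈ L (k + 2 + 1) :=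
        sub_mem (h.mul ih.2 hb) (by rw [add_comm]; exact h.mul hb ih.2)
      constructor
      · have := add_mem (h.anti (by omega : k + 1 + 1 ≤ k + 1 + 1 + 1) g1) g2
        simpa using this
      · have := add_mem g1 g3
        convert this using 1
        noncomm_ring
  have h4 := h3 (p-1)
  set c := (fun z : Aˣ => z * b * z⁻¹ * b⁻¹)^[p-1] a
  rw [show p - 1 + 1 = p by omega, show p - 1 + 2 = p + 1 by omega] at h4
  have h5 := h.anti (by omega : p + 1 ≤ p + p) (h.upow h4.1 Q).2
  rw [hQ] at h5
  have h6 := add_mem (zsmul_mem h4.2 q) h2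
  rw [← smul_add, sub_add_cancel] at h6
  have := add_mem h5 h6
  simpa using this

end ringpart
end DQ

namespace DQ
section grpring
variable (G : Type) [Group G]

noncomputable def Jf (w : ℕ) : AddSubgroup (MonoidAlgebra ℤ G) :=
  if w = 0 then ⊤ else (augIdeal G ^ w).toAddSubgroup

lemma augIdeal_top_mul : (⊤ : Submodule ℤ (MonoidAlgebra ℤ G)) * augIdeal G ≤ augIdeal G := by
  rw [Submodule.mul_le]
  intro x _ y hy
  exact Ideal.mul_mem_left (RingHom.ker ((MonoidAlgebra.lift ℤ ℤ G) 1).toRingHom) x hy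

lemma augIdeal_mul_top : augIdeal G * (⊤ : Submodule ℤ (MonoidAlgebra ℤ G)) ≤ augIdeal G := by
  rw [Submodule.mul_le]
  intro x hx y _
  have hx' : ((MonoidAlgebra.lift ℤ ℤ G) 1).toRingHom x = 0 := hx
  show ((MonoidAlgebra.lift ℤ ℤ G) 1).toRingHom (x * y) = 0
  rw [map_mul, hx', zero_mul]

lemma aug_sub (g : G) : (MonoidAlgebra.of ℤ G g : MonoidAlgebra ℤ G) - 1 ∈ augIdeal G := by
  show ((MonoidAlgebra.lift ℤ ℤ G) 1) (MonoidAlgebra.of ℤ G g - 1) = 0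
  rw [map_sub, MonoidAlgebra.lift_of, MonoidHom.one_apply,
    map_one ((MonoidAlgebra.lift ℤ ℤ G) 1), sub_self]

lemma Jf_filt : Filt (Jf G) where
  zero := by simp [Jf]
  anti := by
    refine antitone_nat_of_succ_le fun w => ?_
    rcases w with _ | w
    · simp [Jf]
    · simp only [Jf, Nat.succ_ne_zero, if_false]
      show augIdeal G ^ (w+1+1) ≤ augIdeal G ^ (w+1)
      rw [pow_succ, pow_succ, mul_assoc]
      exact mul_le_mul_right ((mul_le_mul_right le_top _).trans (augIdeal_mul_top G)) _
  mul := by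
    intro m l x y hx hy
    rcases m with _ | m
    · rcases l with _ | l
      · simp [Jf]
      · simp only [zero_add, Jf, Nat.succ_ne_zero, if_false] at hy ⊢
        have h1 : (⊤ : Submodule ℤ (MonoidAlgebra ℤ G)) * augIdeal G ^ (l+1) ≤ augIdeal G ^ (l+1) := by
          rw [pow_succ', ← mul_assoc]
          exact mul_le_mul_left (augIdeal_top_mul G) _
        exact h1 (Submodule.mul_mem_mul trivial hy)
    · rcases l with _ | l
      · simp only [add_zero, Jf, Nat.succ_ne_zero, if_false] at hx ⊢
        have h1 : augIdeal G ^ (m+1) * (⊤ : Submodule ℤ (MonoidAlgebra ℤ G)) ≤ augIdeal G ^ (m+1) := by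
          rw [pow_succ, mul_assoc]
          exact mul_le_mul_right (augIdeal_mul_top G) _
        exact h1 (Submodule.mul_mem_mul hx trivial)
      · simp only [Jf, Nat.succ_ne_zero, if_false, show m + 1 + (l + 1) ≠ 0 by omega] at hx hy ⊢
        rw [pow_add]
        exact Submodule.mul_mem_mul hx hy

noncomputable def uof : G →* (MonoidAlgebra ℤ G)ˣ := (MonoidAlgebra.of ℤ G).toHomUnits

lemma uof_coe (g : G) : (uof G g : MonoidAlgebra ℤ G) = MonoidAlgebra.of ℤ G g := rfl

variable {G}

lemma gamma_Jf (w : ℕ) : ∀ x ∈ (⊤ : Subgroup G).lowerCentralSeries w,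
    (uof G x : MonoidAlgebra ℤ G) - 1 ∈ Jf G (w+1) := by
  have F := Jf_filt G
  have inv : ∀ m, ∀ z : (MonoidAlgebra ℤ G)ˣ, (z : MonoidAlgebra ℤ G) - 1 ∈ Jf G m →
      ((z⁻¹ : (MonoidAlgebra ℤ G)ˣ) : MonoidAlgebra ℤ G) - 1 ∈ Jf G m := by
    intro m z hz
    have : ((z⁻¹ : (MonoidAlgebra ℤ G)ˣ) : MonoidAlgebra ℤ G) - 1 =
        - (((z : MonoidAlgebra ℤ G) - 1) * ((z⁻¹ : (MonoidAlgebra ℤ G)ˣ) : MonoidAlgebra ℤ G)) := by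
      rw [sub_mul, Units.mul_inv]; simp
    rw [this]
    exact neg_mem (F.mulR _ hz)
  have one : ∀ x : G, (uof G x : MonoidAlgebra ℤ G) - 1 ∈ Jf G 1 := by
    intro x
    simp only [Jf, one_ne_zero, if_false, pow_one]
    exact aug_sub G x
  induction w with
  | zero => intro x _; exact one x
  | succ w ih =>
    let D : Subgroup G :=
      { carrier := {x | (uof G x : MonoidAlgebra ℤ G) - 1 ∈ Jf G (w+1+1)}
        one_mem' := by simp
        mul_mem' := by
          intro x y hx hy
          simp only [Set.mem_ofPred_eq] at hx hy ⊢
          have : ((uof G (x*y) : (MonoidAlgebra ℤ G)ˣ) : MonoidAlgebra ℤ G) - 1 =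
            ((uof G x : MonoidAlgebra ℤ G) - 1) * (uof G y : MonoidAlgebra ℤ G)
              + ((uof G y : MonoidAlgebra ℤ G) - 1) := by
            rw [map_mul]; push_cast; noncomm_ring
          rw [this]
          exact add_mem (F.mulR _ hx) hy
        inv_mem' := by
          intro x hx
          simp only [Set.mem_ofPred_eq] at hx ⊢
          rw [map_inv]
          exact inv _ _ hx }
    suffices (⊤ : Subgroup G).lowerCentralSeries (w+1) ≤ D from fun x hx => this hx
    rw [Subgroup.lowerCentralSeries_succ, Subgroup.commutator_le]
    intro x hx y _
    show (uof G (x * y * x⁻¹ * y⁻¹) : MonoidAlgebra ℤ G) - 1 ∈ Jf G (w+1+1)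
    rw [map_mul, map_mul, map_mul, map_inv, map_inv]
    have h1 := F.anti (Nat.le_succ _) (F.comm (uof G x) (uof G y) (ih x hx) (one y) (one x) (one y))
    have h2 : ((uof G x : MonoidAlgebra ℤ G) - 1) * ((uof G y : MonoidAlgebra ℤ G) - 1) -
      ((uof G y : MonoidAlgebra ℤ G) - 1) * ((uof G x : MonoidAlgebra ℤ G) - 1) ∈ Jf G (w+1+1) :=
      sub_mem (F.mul (ih x hx) (one y)) (by
        have := F.mul (one y) (ih x hx)
        rwa [add_comm 1 (w+1)] at this)
    have := add_mem h1 h2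
    rwa [sub_add_cancel] at this

lemma gamma_Jf' {w : ℕ} (hw : 1 ≤ w) {x : G} (hx : x ∈ gammaGrp G w) :
    (uof G x : MonoidAlgebra ℤ G) - 1 ∈ Jf G w := by
  have := gamma_Jf (w-1) x hx
  rwa [show w - 1 + 1 = w by omega] at this

lemma pow_approx {A : Type} [Ring A] {L : ℕ → AddSubgroup A} (h : Filt L) {H X : A} {q : ℤ}
    (hH : H ∈ L 1) (hX : X - q • H ∈ L 2) (k : ℕ) :
    X ^ k - q ^ k • H ^ k ∈ L (k+1) := by
  have hX1 : X ∈ L 1 := by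
    have := add_mem (h.anti (by omega : 1 ≤ 2) hX) (zsmul_mem hH q)
    rwa [sub_add_cancel] at this
  induction k with
  | zero => simp
  | succ k ih =>
    have e : X ^ (k+1) - q ^ (k+1) • H ^ (k+1) =
        X ^ k * (X - q • H) + (X ^ k - q ^ k • H ^ k) * (q • H) := by
      simp only [pow_succ, mul_sub, sub_mul, smul_mul_smul_comm]
      abel
    rw [e]
    have h1 := h.mul (h.pow hX1 k) hX
    rw [one_mul] at h1
    exact add_mem h1 (h.mul ih (zsmul_mem hH q))

theorem group_main (p : ℕ) (hp : p.Prime) (β : ℕ) (hβ : 1 ≤ β) (q : ℕ) (a b : G)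
    (ha : a ∈ gammaGrp G β) (hb : b ∈ gammaGrp G β) (haq : a ^ (p * q) = 1)
    (H : ∀ h : G, (h = b ∨ ∃ i < p, h = a * b ^ i) → ∃ w1 w2 q1 q2 : ℕ, 1 ≤ w1 ∧ 1 ≤ w2 ∧
      w1 * (p-1) + w2 = (p+1) * β ∧ q1 ^ (p-1) * q2 = q ∧
      h ^ q1 ∈ gammaGrp G w1 ∧ h ^ q2 ∈ gammaGrp G w2) :
    (fun z : G => z * b * z⁻¹ * b⁻¹)^[p-1] a ^ q ∈ dimensionSubgroup G ((p+1) * β) := by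
  have F := Jf_filt G
  let L : ℕ → AddSubgroup (MonoidAlgebra ℤ G) := fun m => Jf G (m * β)
  have FL : Filt L :=
    { zero := by simpa [L] using F.zero
      anti := fun m l hml => F.anti (Nat.mul_le_mul_right β hml)
      mul := by
        intro m l x y hx hy
        have := F.mul hx hy
        rwa [← add_mul] at this }
  have hp2 := hp.two_le
  have hL : ∀ h : G, h ∈ gammaGrp G β → (uof G h : MonoidAlgebra ℤ G) - 1 ∈ L 1 := by
    intro h hh
    have := gamma_Jf' hβ hh
    simpa [L] using this
  have hA := hL a ha
  have hB := hL b hb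
  have key : ∀ h : G, (h = b ∨ ∃ i < p, h = a * b ^ i) →
      (q : ℤ) • ((uof G h : MonoidAlgebra ℤ G) - 1) ^ p ∈ L (p+1) := by
    intro h hh
    have hh1 : h ∈ gammaGrp G β := by
      rcases hh with rfl | ⟨i, _, rfl⟩
      · exact hb
      · exact mul_mem ha (pow_mem hb i)
    have hH := hL h hh1
    obtain ⟨w1, w2, q1, q2, hw1, hw2, hw, hq, h1, h2⟩ := H h hh
    have g1 := gamma_Jf' hw1 h1
    have g2 := gamma_Jf' hw2 h2
    have g3 := F.mul (F.pow g1 (p-1)) g2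
    rw [hw] at g3
    rw [map_pow, Units.val_pow_eq_pow_val, map_pow, Units.val_pow_eq_pow_val] at g3
    set X := (uof G h : MonoidAlgebra ℤ G) - 1 with hX
    have k1 := (FL.upow hH q1)
    have k2 := (FL.upow hH q2)
    rw [← hX] at k1 k2
    have k3 := pow_approx FL hH k1.2 (p-1)
    rw [show p - 1 + 1 = p by omega] at k3
    have k4 := FL.mul k3 k2.1
    have k5 : ((q1 : ℤ) ^ (p-1) • X ^ (p-1)) * ((uof G h : MonoidAlgebra ℤ G) ^ q2 - 1 - (q2 : ℤ) • X)
        ∈ L (1 * (p-1) + 2) := FL.mul (zsmul_mem (FL.pow hH _) _) k2.2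
    rw [show 1 * (p-1) + 2 = p + 1 by omega] at k5
    have := sub_mem (sub_mem (show _ ∈ L (p+1) from g3) k4) k5
    convert this using 1
    rw [← hq]
    push_cast
    have : X ^ p = X ^ (p-1) * X := by rw [← pow_succ]; congr 1; omega
    rw [this]
    clear_value X
    generalize (uof G h : MonoidAlgebra ℤ G) ^ q2 - 1 = Q
    generalize ((uof G h : MonoidAlgebra ℤ G) ^ q1 - 1) ^ (p - 1) = P
    rw [sub_mul, mul_sub, smul_mul_smul_comm]
    abel
  have main := ring_main FL p hp (q : ℤ) (uof G a) (uof G b) hA hB ?_ (key b (Or.inl rfl)) ?_ q rfl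
  · have sc : Function.Semiconj (uof G) (fun z : G => z * b * z⁻¹ * b⁻¹)
        (fun z => z * uof G b * z⁻¹ * (uof G b)⁻¹) := by
      intro z; simp
    rw [← (sc.iterate_right (p-1)).eq a, ← map_pow] at main
    have : (p + 1) * β ≠ 0 := by positivity
    simp only [L, Jf, this, if_false] at main
    exact main
  · intro i hi
    have h1 := key _ (Or.inr ⟨i, hi, rfl⟩)
    set U := (uof G a : MonoidAlgebra ℤ G) - 1 with hU
    set V := (uof G b : MonoidAlgebra ℤ G) - 1 with hV
    set X := (uof G (a * b ^ i) : MonoidAlgebra ℤ G) - 1 with hX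
    have hUV : U + (i : ℤ) • V ∈ L 1 := add_mem hA (zsmul_mem hB _)
    have k1 := FL.upow hB i
    have e : X - (1 : ℤ) • (U + (i : ℤ) • V) ∈ L 2 := by
      have e1 : X - (1 : ℤ) • (U + (i : ℤ) • V) =
        U * ((uof G b : MonoidAlgebra ℤ G) ^ i - 1) +
          ((uof G b : MonoidAlgebra ℤ G) ^ i - 1 - (i : ℤ) • V) := by
        rw [hX, map_mul, map_pow, hU]; push_cast; noncomm_ring
      rw [e1]
      exact add_mem (FL.mul hA k1.1) k1.2
    have k2 := pow_approx FL hUV e p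
    have := sub_mem h1 (zsmul_mem k2 (q : ℤ))
    rw [← smul_sub] at this
    simpa using this
  · have k := (FL.upow hA (p*q)).2
    rw [← Units.val_pow_eq_pow_val, ← map_pow, haq] at k
    simpa using k

end grpring
end DQ

namespace DQ
section concrete
variable {S : Type} [CommRing S]

lemma pow_p_expand (p : ℕ) (hp : p.Prime) (t : S) (ht : t ^ p = 0) :
    ∃ z, (1 + t) ^ p = 1 + p * t + p * t ^ 2 * z := by
  obtain ⟨m, rfl⟩ : ∃ m, p = m + 2 := ⟨p - 2, by have := hp.two_le; omega⟩
  have h1 : ∑ j ∈ Finset.range m, t ^ (j+2) * (((m+2).choose (j+2) : ℕ) : S) ∈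
      Ideal.span ({((m+2 : ℕ) : S) * t ^ 2} : Set S) := by
    refine sum_mem fun j hj => ?_
    rw [Finset.mem_range] at hj
    obtain ⟨c, hc⟩ := hp.dvd_choose_self (k := j+2) (by omega) (by omega)
    rw [hc, Ideal.mem_span_singleton]
    exact ⟨t ^ j * c, by push_cast; ring⟩
  rw [Ideal.mem_span_singleton] at h1
  obtain ⟨z, hz⟩ := h1
  refine ⟨z, ?_⟩
  rw [add_comm 1 t, add_pow, Finset.sum_range_succ', Finset.sum_range_succ', Finset.sum_range_succ]
  simp only [one_pow, mul_one]
  rw [show m + 1 + 1 = m + 2 by omega] at *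
  simp only [add_assoc, one_add_one_eq_two] at *
  rw [ht, hz]
  simp
  ring

lemma pow_pe_expand (p : ℕ) (hp : p.Prime) (x y : S) (hx : x ^ p = 0) (e : ℕ) :
    ∃ z, (1 + x * y) ^ (p ^ e) = 1 + x * ((p : S) ^ e * (y + x * z)) := by
  induction e with
  | zero => exact ⟨0, by simp⟩
  | succ e ih =>
    obtain ⟨z, hz⟩ := ih
    obtain ⟨r, hr⟩ := pow_p_expand p hp (x * ((p : S) ^ e * (y + x * z))) (by
      rw [mul_pow, hx, zero_mul])
    refine ⟨z + (p : S) ^ e * (y + x * z) ^ 2 * r, ?_⟩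
    rw [pow_succ, pow_mul, hz, hr]
    ring

lemma pow_i_expand (x : S) (i : ℕ) : ∃ z, (1 + x) ^ i = 1 + x * (i + x * z) := by
  induction i with
  | zero => exact ⟨0, by simp⟩
  | succ i ih =>
    obtain ⟨z, hz⟩ := ih
    exact ⟨i + z + x * z, by rw [pow_succ, hz]; push_cast; ring⟩

lemma geom_expand (x y : S) (m : ℕ) : ∃ r, ∑ j ∈ Finset.range m, (1 + x * y) ^ j = m + x * r := by
  induction m with
  | zero => exact ⟨0, by simp⟩
  | succ m ih =>
    obtain ⟨r, hr⟩ := ih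
    obtain ⟨z, hz⟩ := pow_i_expand (x * y) m
    exact ⟨r + y * (m + x * y * z), by rw [Finset.sum_range_succ, hr, hz]; push_cast; ring⟩

def DD (S : Type) [CommRing S] (p : ℕ) (x : S) (s : ℕ) (k c : S) : Prop :=
  s = 0 ∨ (1 ≤ s ∧ s ≤ p ∧ k - ((s - 1 : ℕ) : S) * c ∈ Ideal.span ({(p : S), x} : Set S)) ∨
    (p + 1 ≤ s ∧ c ∈ Ideal.span ({(p : S), x} : Set S))

def cl (p β N : ℕ) : (Fin (p+2) ⊕ Fin (p+1)) → ℕ × ℕ × ℕ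
  | Sum.inl s => (β + s, if (s : ℕ) = 0 then 0 else p ^ (s : ℕ), s)
  | Sum.inr s => (2 * β - (p-1) * (s+1), N - (p-1) * p ^ ((s : ℕ)+1), s+1)

def CD (p β N : ℕ) (x : S) : LData S where
  x := x
  P := p
  Λ := Fin (p+2) ⊕ Fin (p+1)
  wt l := (cl p β N l).1
  e l := (cl p β N l).2.1
  dir l := (cl p β N l).2.2
  D := DD S p x
  X0 := Sum.inl 0
  hX0 := by simp [cl]
  Dx := by
    intro s r
    have hx : x * r ∈ Ideal.span ({(p : S), x} : Set S) :=
      Ideal.mul_mem_right _ _ (Ideal.subset_span (by simp))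
    by_cases h0 : s = 0
    · exact Or.inl h0
    by_cases h1 : s ≤ p
    · exact Or.inr (Or.inl ⟨by omega, h1, by simpa using hx⟩)
    · exact Or.inr (Or.inr ⟨by omega, zero_mem _⟩)
  det := by
    intro s hs k c k' c' h h'
    rcases h with h | ⟨_, h2, h⟩ | ⟨h2, h⟩
    · omega
    · rcases h' with h' | ⟨_, h2', h'⟩ | ⟨h2', h'⟩
      · omega
      · have := sub_mem (Ideal.mul_mem_left _ c' h) (Ideal.mul_mem_left _ c h')
        convert this using 1; ring
      · omega
    · rcases h' with h' | ⟨_, h2', h'⟩ | ⟨h2', h'⟩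
      · omega
      · omega
      · exact sub_mem (Ideal.mul_mem_left _ _ h') (Ideal.mul_mem_left _ _ h)


lemma num (p β N : ℕ) (hp : 2 ≤ p) (hβ : (p+1) * (p+1) < β) (hN : 2 * ((p-1) * p ^ (p+1)) + 1 ≤ N)
    (x : S) (W : Multiset (Fin (p+2) ⊕ Fin (p+1))) (C : ℕ)
    (hG : (CD p β N x).Good ((p+1) * β) W C) (hW : Multiset.card W ≤ p) : N + 1 ≤ C := by
  obtain ⟨h1, h2, h3, h4⟩ := hG
  simp only [CD] at h2 h3 h4
  have heY : ∀ s : Fin (p+1), (p-1) * p ^ ((s : ℕ)+1) ≤ (p-1) * p ^ (p+1) := fun s =>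
    Nat.mul_le_mul_left _ (Nat.pow_le_pow_right (by omega) (by omega))
  by_cases hY : ∃ s, Sum.inr s ∈ W
  swap
  · exfalso
    have : (W.map fun l => (cl p β N l).1).sum ≤ Multiset.card (W.map fun l => (cl p β N l).1) • (β + p + 1) := by
      refine Multiset.sum_le_card_nsmul _ _ ?_
      intro y hy
      obtain ⟨l, hl, rfl⟩ := Multiset.mem_map.1 hy
      rcases l with s | s
      · have := s.2
        simp only [cl]; omega
      · exact absurd ⟨s, hl⟩ hY
    rw [Multiset.card_map, smul_eq_mul] at this
    nlinarith [Nat.mul_le_mul_right (β + p + 1) hW]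
  obtain ⟨s, hs⟩ := hY
  obtain ⟨W', rfl⟩ := Multiset.exists_cons_of_mem hs
  simp only [Multiset.map_cons, Multiset.sum_cons, Multiset.card_cons] at h1 h2 h3 h4 hW
  have hs2 := s.2
  have eY : (cl p β N (Sum.inr s)).2.1 = N - (p-1) * p ^ ((s : ℕ)+1) := rfl
  have wY : (cl p β N (Sum.inr s)).1 = 2 * β - (p-1) * ((s : ℕ)+1) := rfl
  have dY : (cl p β N (Sum.inr s)).2.2 = s + 1 := rfl
  by_cases hY : ∃ s, Sum.inr s ∈ W'
  · obtain ⟨s', hs'⟩ := hY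
    obtain ⟨W'', rfl⟩ := Multiset.exists_cons_of_mem hs'
    simp only [Multiset.map_cons, Multiset.sum_cons] at h3
    have eY' : (cl p β N (Sum.inr s')).2.1 = N - (p-1) * p ^ ((s' : ℕ)+1) := rfl
    have := heY s
    have := heY s'
    omega
  have hX : ∀ l ∈ W', ∃ r, l = Sum.inl r := by
    intro l hl
    rcases l with r | r
    · exact ⟨r, rfl⟩
    · exact absurd ⟨r, hl⟩ hY
  have w1 : (W'.map fun l => (cl p β N l).1).sum =
      Multiset.card W' * β + (W'.map fun l => (cl p β N l).2.2).sum := by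
    rw [← smul_eq_mul, ← Multiset.sum_replicate, ← Multiset.map_const', ← Multiset.sum_map_add]
    congr 1
    refine Multiset.map_congr rfl fun l hl => ?_
    obtain ⟨r, rfl⟩ := hX l hl
    rfl
  have w2 : ∀ V ≤ W', ∀ t, (∀ l ∈ V, (cl p β N l).2.2 ≤ t) →
      (V.map fun l => (cl p β N l).2.2).sum ≤ Multiset.card V * t := by
    intro V _ t ht
    have := Multiset.sum_le_card_nsmul (V.map fun l => (cl p β N l).2.2) t (by
      intro y hy
      obtain ⟨l, hl, rfl⟩ := Multiset.mem_map.1 hy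
      exact ht l hl)
    simpa using this
  have w3 := w2 W' le_rfl (p+1) (by
    intro l hl
    obtain ⟨r, rfl⟩ := hX l hl
    have := r.2
    simp only [cl]; omega)
  set c := Multiset.card W' with hc
  set sd := (W'.map fun l => (cl p β N l).2.2).sum
  rw [w1, wY] at h2
  set t := (s : ℕ) + 1 with ht
  have hpt : (p-1) * t ≤ 2 * β := by
    have : (p-1) * t ≤ (p+1) * (p+1) := Nat.mul_le_mul (by omega) (by omega)
    omega
  have hcp : c = p - 1 := by
    by_contra hne
    have hc2 : c + 2 ≤ p := by omega
    have a1 : c * β + 2 * β ≤ p * β := by rw [← add_mul]; exact Nat.mul_le_mul_right _ hc2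
    have a2 : c * (p+1) ≤ (p+1) * (p+1) := Nat.mul_le_mul_right _ (by omega)
    have a3 : (p+1) * β = p * β + β := by ring
    omega
  have hsum : c * t ≤ sd := by
    rw [hcp] at h2 ⊢
    have a3 : (p+1) * β = (p-1) * β + 2 * β := by
      rw [← add_mul]; congr 1; omega
    omega
  have heYs := heY s
  rw [← ht] at heYs
  by_cases hall : ∀ l ∈ W', (cl p β N l).2.2 = t
  · have g := h4 ⟨t, by omega, by
      intro l hl
      rcases Multiset.mem_cons.1 hl with rfl | hl
      · rfl
      · exact hall l hl⟩
    have : c * p ^ t ≤ (W'.map fun l => (cl p β N l).2.1).sum := by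
      have := Multiset.card_nsmul_le_sum (s := W'.map fun l => (cl p β N l).2.1) (a := p ^ t) (by
        intro y hy
        obtain ⟨l, hl, rfl⟩ := Multiset.mem_map.1 hy
        have h := hall l hl
        obtain ⟨r, rfl⟩ := hX l hl
        simp only [cl] at h ⊢
        rw [if_neg (by omega), h])
      simpa using this
    rw [hcp] at this
    omega
  · have : ∃ l ∈ W', t < (cl p β N l).2.2 := by
      by_contra hcon
      push Not at hcon
      push Not at hall
      obtain ⟨l, hl, hlt⟩ := hall
      obtain ⟨V, rfl⟩ := Multiset.exists_cons_of_mem hl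
      have b1 := w2 V (Multiset.le_cons_self _ _) t (fun l hl => hcon l (Multiset.mem_cons_of_mem hl))
      have b2 := hcon l hl
      have b3 : sd = (cl p β N l).2.2 + (V.map fun l => (cl p β N l).2.2).sum := by simp [sd]
      have b4 : c = Multiset.card V + 1 := by simp [hc]
      rw [b4, add_mul] at hsum
      omega
    obtain ⟨l, hl, hlt⟩ := this
    have b : p ^ (t+1) ≤ (W'.map fun l => (cl p β N l).2.1).sum := by
      refine le_trans ?_ (Multiset.single_le_sum (by simp) _
        (Multiset.mem_map_of_mem (fun l => (cl p β N l).2.1) hl))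
      obtain ⟨r, rfl⟩ := hX l hl
      simp only [cl] at hlt ⊢
      rw [if_neg (by omega)]
      exact Nat.pow_le_pow_right (by omega) (by omega)
    have b2 : p ^ (t+1) = (p-1) * p ^ t + p ^ t := by
      rw [pow_succ, mul_comm]
      conv_lhs => rw [show p = (p - 1) + 1 by omega]
      rw [add_mul, one_mul, show p - 1 + 1 = p by omega]
    have b3 : 1 ≤ p ^ t := Nat.one_le_pow _ _ (by omega)
    omega

end concrete
end DQ

namespace DQ

lemma exists_ring (p N : ℕ) (hp : p.Prime) : ∃ (S : Type) (_ : CommRing S) (x : S),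
    x ^ p = 0 ∧ (p : S) ^ (N+1) = 0 ∧ (p : S) ^ N * x ^ (p-1) ≠ 0 := by
  refine ⟨AdjoinRoot (Polynomial.X ^ p : Polynomial (ZMod (p ^ (N+1)))), inferInstance,
    AdjoinRoot.mk _ Polynomial.X, ?_, ?_, ?_⟩
  · rw [← map_pow, AdjoinRoot.mk_self]
  · have h : ((p ^ (N+1) : ℕ) : ZMod (p ^ (N+1))) = 0 := ZMod.natCast_self _
    have := congrArg (AdjoinRoot.of (Polynomial.X ^ p : Polynomial (ZMod (p ^ (N+1))))) h
    rw [map_natCast, map_zero] at this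
    rw [← Nat.cast_pow]; exact this
  · have e : ((p : AdjoinRoot (Polynomial.X ^ p : Polynomial (ZMod (p ^ (N+1))))) ^ N *
        (AdjoinRoot.mk _ Polynomial.X) ^ (p-1)) =
        AdjoinRoot.mk _ ((p : Polynomial (ZMod (p ^ (N+1)))) ^ N * Polynomial.X ^ (p-1)) := by
      simp
    rw [e, Ne, AdjoinRoot.mk_eq_zero, Polynomial.X_pow_dvd_iff]
    intro h
    have h1 := h (p-1) (by have := hp.two_le; omega)
    have e2 : ((p : Polynomial (ZMod (p ^ (N+1)))) ^ N) =
      Polynomial.C ((p ^ N : ℕ) : ZMod (p ^ (N+1))) := by simp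
    rw [e2, Polynomial.coeff_C_mul_X_pow, if_pos rfl, ZMod.natCast_eq_zero_iff] at h1
    have := (Nat.pow_dvd_pow_iff_le_right hp.one_lt).1 h1
    omega

theorem final (p : ℕ) (hp : p.Prime) :
    ∃ (G : Type) (_ : Group G) (n : ℕ) (g : G), 1 ≤ n ∧
      g ∈ dimensionSubgroup G n ∧ g ∉ gammaGrp G n ∧ g ^ p ∈ gammaGrp G n := by
  have hp2 := hp.two_le
  obtain ⟨β, hβ⟩ : ∃ β, β = (p+1) * (p+1) + 1 := ⟨_, rfl⟩
  obtain ⟨N, hN⟩ : ∃ N, N = 2 * ((p-1) * p ^ (p+1)) + 1 := ⟨_, rfl⟩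
  obtain ⟨S, _, x, hx, hP, hne⟩ := exists_ring p N hp
  let d := CD p β N x
  have dx : d.x = x := rfl
  have dX0 : d.wt d.X0 = β := by simp [d, CD, cl]
  have hnil : ∀ y, IsNilpotent (x * y) := fun y => ⟨p, by rw [mul_pow, hx, zero_mul]⟩
  have bot : d.E ((p+1) * β) = ⊥ := by
    refine d.E_bot _ ?_ ?_
    · intro l
      have h3 : 2 * β < (p+1) * β := Nat.mul_lt_mul_of_pos_right (by omega) (by omega)
      rcases l with s | s
      · have := s.2
        have h4 : p + 1 ≤ (p+1) * (p+1) := Nat.le_mul_self _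
        simp only [d, CD, cl]; omega
      · simp only [d, CD, cl]; omega
    · intro W C hG
      by_cases hW : Multiset.card W ≤ p
      · have := num p β N hp2 (by omega) (by omega) x W C hG hW
        obtain ⟨m, rfl⟩ : ∃ m, C = N + 1 + m := ⟨C - (N+1), by omega⟩
        have : d.P = (p : S) := rfl
        rw [this, pow_add, hP, zero_mul, zero_mul]
      · obtain ⟨m, hm⟩ : ∃ m, Multiset.card W - 1 = p + m := ⟨Multiset.card W - 1 - p, by omega⟩
        rw [hm, dx, pow_add, hx, zero_mul, mul_zero]
  obtain ⟨G, _, ι, inj, hι, hbot⟩ := exists_group d.E ((p+1)*β) (by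
    have : 2 ≤ p + 1 := by omega
    exact le_trans this (Nat.le_mul_of_pos_right _ (by omega))) d.E_anti d.E_comm bot
  -- the elements
  obtain ⟨ub, hub⟩ : IsUnit (1 + x) := by
    have := (hnil 1).isUnit_one_add
    simpa using this
  let A : Aff S := ⟨1, 1⟩
  let B : Aff S := ⟨ub, 0⟩
  have full : ∀ w, w ≤ β → ∀ a : Aff S, ∀ k, (a.u : S) = 1 + x * k → a ∈ d.E w := fun w hw a k hk =>
    d.E_full (fun _ _ => Or.inl rfl) w (by rw [dX0]; exact hw) a k hk
  have hA : ∀ w, w ≤ β → A ∈ d.E w := fun w hw => full w hw A 0 (by simp [A])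
  have hB : ∀ w, w ≤ β → B ∈ d.E w := fun w hw => full w hw B 1 (by simp [B, hub])
  let a : d.E 1 := ⟨A, hA 1 (by omega)⟩
  let b : d.E 1 := ⟨B, hB 1 (by omega)⟩
  have hApow : ∀ m : ℕ, ∀ c : S, (⟨1, c⟩ : Aff S) ^ m = ⟨1, m * c⟩ := by
    intro m c
    ext
    · simp [Aff.pow_u]
    · simp [Aff.pow_f, mul_comm]
  have key : ∀ (h : d.E 1) (s : ℕ) (hs : 1 ≤ s ∧ s ≤ p + 1) (y : S),
      ((h : Aff S).u : S) = 1 + x * y → (∀ z, DD S p x s (y + x * z) (h : Aff S).f) →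
      ∃ w1 w2 q1 q2 : ℕ, 1 ≤ w1 ∧ 1 ≤ w2 ∧ w1 * (p-1) + w2 = (p+1) * β ∧
        q1 ^ (p-1) * q2 = p ^ N ∧ (ι h) ^ q1 ∈ gammaGrp G w1 ∧ (ι h) ^ q2 ∈ gammaGrp G w2 := by
    intro h s hs y hu hD
    have L : ∀ l : d.Λ, 1 ≤ d.wt l → d.wt l ≤ 2 * β → d.dir l = s →
        (ι h) ^ (p ^ d.e l) ∈ gammaGrp G (d.wt l) := by
      intro l hl1 hl2 hl3
      rw [← map_pow]
      refine hι _ hl1 _ ?_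
      obtain ⟨z, hz⟩ := pow_pe_expand p hp x y hx (d.e l)
      obtain ⟨r, hr⟩ := geom_expand x y (p ^ d.e l)
      refine d.E_letter l (by rw [dX0]; exact hl2) _ (y + x * z) (h : Aff S).f ?_ ?_
        ((h : Aff S).f * r) ?_
      · rw [hl3]; exact hD z
      · rw [SubmonoidClass.coe_pow, Aff.pow_u, Units.val_pow_eq_pow_val, hu, hz]; rfl
      · rw [SubmonoidClass.coe_pow, Aff.pow_f, hu, hr]
        have : d.P = (p : S) := rfl
        rw [this, dx]; push_cast; ring
    have hps : (p-1) * s ≤ (p+1) * (p+1) := Nat.mul_le_mul (by omega) (by omega)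
    have h5 : (p-1) * p ^ s ≤ (p-1) * p ^ (p+1) :=
      Nat.mul_le_mul_left _ (Nat.pow_le_pow_right (by omega) hs.2)
    have L1 := L (Sum.inl ⟨s, by omega⟩)
    have L2 := L (Sum.inr ⟨s - 1, by omega⟩)
    have h4 : p + 1 ≤ (p+1) * (p+1) := Nat.le_mul_self _
    simp only [d, CD, cl] at L1 L2
    rw [if_neg (by omega)] at L1
    rw [show s - 1 + 1 = s by omega] at L2
    refine ⟨β + s, 2 * β - (p-1) * s, p ^ p ^ s, p ^ (N - (p-1) * p ^ s), by omega, by omega, ?_, ?_,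
      L1 (by omega) (by omega) trivial, L2 (by omega) (by omega) rfl⟩
    · obtain ⟨m, rfl⟩ : ∃ m, p = m + 1 := ⟨p - 1, by omega⟩
      simp only [Nat.add_sub_cancel] at *
      have : (β + s) * m = β * m + m * s := by ring
      have : (m + 1 + 1) * β = β * m + 2 * β := by ring
      omega
    · rw [← pow_mul, ← pow_add]
      congr 1
      rw [mul_comm]; omega
  have hiter : ∀ k : ℕ, (((fun z : d.E 1 => z * b * z⁻¹ * b⁻¹)^[k] a : d.E 1) : Aff S) =
      ⟨1, (-x) ^ k⟩ := by
    intro k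
    induction k with
    | zero => simp [a, A]
    | succ k ih =>
      rw [Function.iterate_succ_apply']
      simp only [Subgroup.coe_mul, Subgroup.coe_inv]
      rw [Aff.comm, ih]
      ext
      · rfl
      · simp [b, B, hub, pow_succ, mul_comm]
  set c := (fun z : d.E 1 => z * b * z⁻¹ * b⁻¹)^[p-1] a with hc
  have hcG : (fun z : G => z * ι b * z⁻¹ * (ι b)⁻¹)^[p-1] (ι a) = ι c := by
    have sc : Function.Semiconj ι (fun z : d.E 1 => z * b * z⁻¹ * b⁻¹)
        (fun z => z * ι b * z⁻¹ * (ι b)⁻¹) := by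
      intro z; simp
    exact ((sc.iterate_right (p-1)).eq a).symm
  have main := group_main p hp β (by omega) (p ^ N) (ι a) (ι b)
    (hι β (by omega) a (hA β le_rfl)) (hι β (by omega) b (hB β le_rfl)) ?_ ?_
  · rw [hcG] at main
    refine ⟨G, inferInstance, (p+1) * β, ι c ^ p ^ N, ?_, main, ?_, ?_⟩
    · exact Nat.mul_pos (by omega) (by omega)
    · rw [hbot, Subgroup.mem_bot, ← map_pow, map_eq_one_iff ι inj]
      intro h
      have h1 := congrArg (fun z : d.E 1 => (z : Aff S).f) h
      simp only [SubmonoidClass.coe_pow, hiter (p-1), hApow, hc] at h1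
      apply hne
      rcases Nat.even_or_odd (p-1) with he | ho
      · rw [he.neg_pow] at h1; simpa using h1
      · rw [ho.neg_pow] at h1; simpa using h1
    · rw [hbot, Subgroup.mem_bot, ← map_pow, ← map_pow, map_eq_one_iff ι inj]
      apply Subtype.ext
      rw [← pow_mul, ← pow_succ]
      simp only [SubmonoidClass.coe_pow, hiter (p-1), hApow, hc]
      push_cast
      rw [hP, zero_mul]; rfl
  · rw [← map_pow, map_eq_one_iff ι inj]
    apply Subtype.ext
    rw [← pow_succ']
    simp only [SubmonoidClass.coe_pow, a, A, hApow]
    push_cast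
    rw [hP, zero_mul]; rfl
  · have hxm : ∀ z, x * z ∈ Ideal.span ({(p : S), x} : Set S) := fun z =>
      Ideal.mul_mem_right _ _ (Ideal.subset_span (by simp))
    rintro h (rfl | ⟨i, hi, rfl⟩)
    · exact key b (p+1) (by omega) 1 (by simp [b, B, hub]) fun z =>
        Or.inr (Or.inr ⟨le_rfl, by simp [b, B]⟩)
    · obtain ⟨z, hz⟩ := pow_i_expand x i
      have := key (a * b ^ i) (i+1) (by omega) (i + x * z)
        (by simp [a, A, b, B, Aff.pow_u, hub, hz]) fun z' => Or.inr (Or.inl ⟨by omega, by omega, ?_⟩)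
      · simpa using this
      · convert hxm (z + z') using 1
        simp [a, A, b, B, Aff.pow_f]; ring
end DQ

/-- For every prime `p` there exist a group `G`, an integer `n ≥ 1` and `g ∈ G` with
`g ∈ δ_n(G)`, `g ∉ γ_n(G)` and `g^p ∈ γ_n(G)`:  the dimension quotient
`δ_n(G)/γ_n(G)` contains an element of order `p`. -/
theorem dimension_quotient_contains_p_torsion (p : ℕ) (hp : p.Prime) :
    ∃ (G : Type) (_ : Group G) (n : ℕ) (g : G), 1 ≤ n ∧
      g ∈ dimensionSubgroup G n ∧ g ∉ gammaGrp G n ∧ g ^ p ∈ gammaGrp G n := by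
  exact DQ.final p hp
end

section
/- For every prime p there exist a Lie ring A (Lie algebra over ℤ), an integer n ≥ 1, and an element a ∈ A such that a lies in the n-th dimension subring δ_n(A), a does not lie in γ_n(A), and p·a lies in γ_n(A); in other words, the dimension quotient δ_n(A)/γ_n(A) contains an element of order p. -/
/-- The augmentation ideal of the universal enveloping algebra `U(A)` of a Lie ring `A`:
the two-sided ideal generated by the image of `A`, viewed as a `ℤ`-submodule
(so that its powers make sense). -/
noncomputable def augIdealLie (A : Type*) [LieRing A] [LieAlgebra ℤ A] :
    Submodule ℤ (UniversalEnvelopingAlgebra ℤ A) :=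
  Submodule.span ℤ
    {x | ∃ (l r : UniversalEnvelopingAlgebra ℤ A) (m : A),
      x = l * (UniversalEnvelopingAlgebra.ι ℤ m) * r}

/-- The `n`-th dimension subring `δ_n(A) = {a ∈ A : ι(a) ∈ ϖ^n}`. -/
noncomputable def dimensionSubring (A : Type*) [LieRing A] [LieAlgebra ℤ A] (n : ℕ) : Set A :=
  {a : A | (UniversalEnvelopingAlgebra.ι ℤ a) ∈ (augIdealLie A) ^ n}

/-- `γ_n(A)`, the `n`-th term of the lower central series of Lie ideals, with `γ_1(A) = A`. -/
def gammaLie (A : Type*) [LieRing A] [LieAlgebra ℤ A] (n : ℕ) : LieSubmodule ℤ A A :=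
  LieModule.lowerCentralSeries ℤ A A (n - 1)


section UPart

theorem choose_aux (p : ℕ) (hp : p.Prime) (k : ℕ) (hk : k < p) :
    (p : ℤ) ∣ ((p - 1).choose k : ℤ) - (-1) ^ k := by
  induction k with
  | zero => simp
  | succ k ih =>
    have h1 := ih (by omega)
    have h2 : (p : ℤ) ∣ (p.choose (k + 1) : ℤ) := by
      exact_mod_cast hp.dvd_choose_self (by omega) hk
    have h3 : p.choose (k + 1) = (p - 1).choose k + (p - 1).choose (k + 1) := by
      obtain ⟨q, rfl⟩ : ∃ q, p = q + 1 := ⟨p - 1, by omega⟩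
      exact Nat.choose_succ_succ q k
    rw [h3] at h2
    push_cast at h2
    obtain ⟨d, hd⟩ := h1
    obtain ⟨e, he⟩ := h2
    refine ⟨e - d, ?_⟩
    rw [pow_succ, mul_sub, ← hd, ← he]
    ring

/-- the linearised p-th power -/
theorem pow_aux {U : Type*} [Ring U] (X Z : U) (q c : ℤ) (h : ((c * q * q : ℤ) : U) * X = 0) (m : ℕ) :
    (c : U) * (Z + (q : U) * X) ^ m =
      (c : U) * Z ^ m + ((c * q : ℤ) : U) * ∑ k ∈ Finset.range m, Z ^ k * X * Z ^ (m - 1 - k) := by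
  induction m with
  | zero => simp
  | succ m ih =>
    have hc : ∀ (n : ℤ) (a : U), a * (n : U) = n * a := fun n a => (Int.cast_commute n a).eq.symm
    rw [pow_succ, ← mul_assoc, ih, add_mul, Finset.sum_range_succ, mul_add, mul_add]
    have e1 : ((c * q : ℤ) : U) * (∑ k ∈ Finset.range m, Z ^ k * X * Z ^ (m - 1 - k)) * ((q : U) * X) = 0 := by
      rw [← mul_assoc, hc, ← mul_assoc, Finset.mul_sum, Finset.sum_mul]
      apply Finset.sum_eq_zero
      intro k _
      have : (q : U) * ((c * q : ℤ) : U) = ((c * q * q : ℤ) : U) := by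
        rw [← Int.cast_mul]; congr 1; ring
      have h' : ((c * q * q : ℤ) : U) * (Z ^ k * X * Z ^ (m - 1 - k)) = 0 := by
        rw [← mul_assoc, ← mul_assoc, ← hc, mul_assoc (Z ^ k), h]
        simp
      rw [this, h', zero_mul]
    have e2 : ((c * q : ℤ) : U) * (∑ k ∈ Finset.range m, Z ^ k * X * Z ^ (m - 1 - k)) * Z =
        ((c * q : ℤ) : U) * ∑ k ∈ Finset.range m, Z ^ k * X * Z ^ (m + 1 - 1 - k) := by
      rw [mul_assoc, Finset.sum_mul]
      congr 1
      apply Finset.sum_congr rfl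
      intro k hk
      rw [Finset.mem_range] at hk
      rw [mul_assoc, ← pow_succ]
      congr 2
      omega
    rw [mul_add, e1, e2]
    have e3 : (c : U) * Z ^ m * ((q : U) * X) = ((c * q : ℤ) : U) * (Z ^ m * X * Z ^ (m + 1 - 1 - m)) := by
      simp only [Nat.add_sub_cancel, Nat.sub_self, pow_zero, mul_one]
      rw [← mul_assoc, mul_assoc (c : U), hc]
      push_cast
      simp only [mul_assoc]
    rw [e3, mul_assoc, ← pow_succ]
    abel

theorem ad_aux {U : Type*} [Ring U] (X Z : U) (m : ℕ) :
    (fun y => Z * y - y * Z)^[m] X =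
      ∑ k ∈ Finset.range (m + 1), ((-1 : ℤ) ^ k * (m.choose k : ℤ)) • (Z ^ (m - k) * X * Z ^ k) := by
  have key : Commute (LinearMap.mulLeft ℤ Z) (-(LinearMap.mulRight ℤ Z)) := by
    apply Commute.neg_right
    ext y
    simp [mul_assoc]
  have h1 : ∀ n, (fun y => Z * y - y * Z)^[n] X =
      ((LinearMap.mulLeft ℤ Z + -(LinearMap.mulRight ℤ Z)) ^ n) X := by
    intro n
    induction n with
    | zero => simp
    | succ n ih =>
      rw [Function.iterate_succ_apply', ih, pow_succ']
      simp [sub_eq_add_neg]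
  rw [h1, add_comm, key.symm.add_pow, LinearMap.sum_apply]
  apply Finset.sum_congr rfl
  intro k _
  rw [neg_pow]
  have h2 : ∀ n y, (LinearMap.mulLeft ℤ Z ^ n) y = Z ^ n * y := by
    intro n y; rw [LinearMap.pow_mulLeft]; simp
  have h3 : ∀ n y, (LinearMap.mulRight ℤ Z ^ n) y = y * Z ^ n := by
    intro n y; rw [LinearMap.pow_mulRight]; simp
  have h4 : ∀ y : Module.End ℤ U, ((-1 : Module.End ℤ U) ^ k * y) = ((-1 : ℤ) ^ k) • y := by
    intro y
    rcases Nat.even_or_odd k with h | h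
    · simp [h.neg_one_pow]
    · simp [h.neg_one_pow]
  have h5 : ∀ y : Module.End ℤ U, y * ((m.choose k : ℕ) : Module.End ℤ U) = (m.choose k : ℤ) • y := by
    intro y
    rw [(Nat.cast_commute _ y).eq.symm]
    simp
  rw [h4, h5, LinearMap.smul_apply, smul_mul_assoc, LinearMap.smul_apply, Module.End.mul_apply, h2, h3, smul_smul,
    mul_comm ((m.choose k : ℤ)), mul_assoc]

variable {A : Type*} [LieRing A]

theorem lcs_induct (P : ℕ → A → Prop) (h0 : ∀ a, P 0 a)
    (hz : ∀ k, P k 0) (hadd : ∀ k a b, P k a → P k b → P k (a + b))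
    (hneg : ∀ k a, P k a → P k (-a))
    (hs : ∀ (k : ℕ) (a b : A), b ∈ LieModule.lowerCentralSeries ℤ A A k → P k b → P (k + 1) ⁅a, b⁆) :
    ∀ k a, a ∈ LieModule.lowerCentralSeries ℤ A A k → P k a := by
  intro k
  induction k with
  | zero => intro a _; exact h0 a
  | succ k ih =>
    intro a ha
    rw [LieModule.lowerCentralSeries_succ, ← LieSubmodule.mem_toSubmodule,
      LieSubmodule.lieIdeal_oper_eq_linear_span'] at ha
    induction ha using Submodule.span_induction with
    | mem x hx =>
      obtain ⟨x, _, n, hn, rfl⟩ := hx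
      exact hs k x n hn (ih n hn)
    | zero => exact hz _
    | add x y _ _ hx hy => exact hadd _ _ _ hx hy
    | smul c x _ hx =>
      have hnat : ∀ n : ℕ, P (k + 1) ((n : ℤ) • x) := by
        intro n
        induction n with
        | zero => simpa using hz _
        | succ n ihn =>
          rw [Nat.cast_succ, add_smul, one_smul]
          exact hadd _ _ _ ihn hx
      obtain ⟨n, rfl | rfl⟩ := c.eq_nat_or_neg
      · exact hnat n
      · rw [neg_smul]; exact hneg _ _ (hnat n)

theorem iota_lie (a b : A) : UniversalEnvelopingAlgebra.ι ℤ ⁅a, b⁆ =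
    UniversalEnvelopingAlgebra.ι ℤ a * UniversalEnvelopingAlgebra.ι ℤ b
      - UniversalEnvelopingAlgebra.ι ℤ b * UniversalEnvelopingAlgebra.ι ℤ a := by
  let _ : LieRing (UniversalEnvelopingAlgebra ℤ A) := LieRing.ofAssociativeRing
  exact (UniversalEnvelopingAlgebra.ι ℤ).map_lie a b

theorem iota_mem_aug (a : A) : UniversalEnvelopingAlgebra.ι ℤ a ∈ augIdealLie A :=
  Submodule.subset_span ⟨1, 1, a, by simp⟩

theorem gamma_sub (k : ℕ) (a : A) (ha : a ∈ LieModule.lowerCentralSeries ℤ A A k) :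
    UniversalEnvelopingAlgebra.ι ℤ a ∈ (augIdealLie A) ^ (k + 1) := by
  refine lcs_induct (fun k a => UniversalEnvelopingAlgebra.ι ℤ a ∈ (augIdealLie A) ^ (k + 1))
    ?_ ?_ ?_ ?_ ?_ k a ha
  · intro a; rw [zero_add, Submodule.pow_one]; exact iota_mem_aug a
  · intro k; simp
  · intro k a b h1 h2; simpa using Submodule.add_mem _ h1 h2
  · intro k a h1; simpa using Submodule.neg_mem _ h1
  · intro k a b _ hb
    rw [iota_lie]
    apply Submodule.sub_mem
    · rw [Submodule.pow_succ' _ (Nat.succ_ne_zero k)]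
      exact Submodule.mul_mem_mul (iota_mem_aug a) hb
    · rw [Submodule.pow_succ]
      exact Submodule.mul_mem_mul hb (iota_mem_aug a)

theorem aug_mul {m n : ℕ} (hn : n ≠ 0) {a b : UniversalEnvelopingAlgebra ℤ A}
    (ha : a ∈ (augIdealLie A) ^ m) (hb : b ∈ (augIdealLie A) ^ n) :
    a * b ∈ (augIdealLie A) ^ (m + n) := by
  rw [Submodule.pow_add _ hn]
  exact Submodule.mul_mem_mul ha hb

theorem aug_pow {m : ℕ} (hm : m ≠ 0) {a : UniversalEnvelopingAlgebra ℤ A}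
    (ha : a ∈ (augIdealLie A) ^ m) (k : ℕ) : a ^ (k + 1) ∈ (augIdealLie A) ^ (m * (k + 1)) := by
  induction k with
  | zero => simpa using ha
  | succ k ih =>
    rw [pow_succ, Nat.mul_succ m (k + 1)]
    exact aug_mul hm ih ha

theorem delta_main (p : ℕ) (hp : p.Prime) (x z : A)
    (hx : ((p : ℤ) ^ (2 * p + 2)) • x = 0)
    (hu : ((p : ℤ) ^ 3) • x + ((p : ℤ) ^ 2) • z ∈ LieModule.lowerCentralSeries ℤ A A 2)
    (hz : z ∈ LieModule.lowerCentralSeries ℤ A A 1)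
    (hv : ((p : ℤ) ^ (2 * p)) • z ∈ LieModule.lowerCentralSeries ℤ A A (p + 1)) :
    ((p : ℤ) ^ (2 * p + 1)) • (fun y => ⁅z, y⁆)^[p - 1] x ∈ dimensionSubring A (3 * p) := by
  have hp1 := hp.one_lt
  set X := UniversalEnvelopingAlgebra.ι ℤ x with hX
  set Z := UniversalEnvelopingAlgebra.ι ℤ z with hZ
  have hX0 : (((p : ℤ) ^ (2 * p) * p * p : ℤ) : UniversalEnvelopingAlgebra ℤ A) * X = 0 := by
    rw [← zsmul_eq_mul, mul_assoc, ← sq, ← pow_add, hX, ← map_zsmul, hx, map_zero]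
  have hP := pow_aux X Z p ((p : ℤ) ^ (2 * p)) hX0 p
  have hU := gamma_sub _ _ hu
  have hV := gamma_sub _ _ hv
  have hZ2 := gamma_sub _ _ hz
  -- first term
  have m1 : (((p : ℤ) ^ (2 * p) : ℤ) : UniversalEnvelopingAlgebra ℤ A) * (Z + ((p : ℤ) : UniversalEnvelopingAlgebra ℤ A) * X) ^ p
      ∈ augIdealLie A ^ (3 * p) := by
    have := aug_pow (by norm_num) hU (p - 1)
    rw [Nat.sub_add_cancel hp1.le] at this
    convert this using 1
    rw [map_add, map_zsmul, map_zsmul, ← hX, ← hZ]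
    have : (p : ℤ) ^ 3 • X + (p : ℤ) ^ 2 • Z = ((p : ℤ) ^ 2) • (Z + ((p : ℤ) : UniversalEnvelopingAlgebra ℤ A) * X) := by
      rw [smul_add, ← zsmul_eq_mul, smul_smul, add_comm]
      congr 2
    rw [this, smul_pow, ← pow_mul, zsmul_eq_mul]
  have m2 : (((p : ℤ) ^ (2 * p) : ℤ) : UniversalEnvelopingAlgebra ℤ A) * Z ^ p ∈ augIdealLie A ^ (3 * p) := by
    have h1 := aug_pow (by norm_num) hZ2 (p - 2)
    have e0 : p - 2 + 1 = p - 1 := by omega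
    rw [e0] at h1
    have h2 := aug_mul (by omega) hV h1
    have e : p + 1 + 1 + (1 + 1) * (p - 1) = 3 * p := by omega
    rw [e, map_zsmul, ← hZ, smul_mul_assoc, ← pow_succ', Nat.sub_add_cancel hp1.le, zsmul_eq_mul] at h2
    exact h2
  have m3 : (((p : ℤ) ^ (2 * p) * p : ℤ) : UniversalEnvelopingAlgebra ℤ A) *
      ∑ k ∈ Finset.range p, Z ^ k * X * Z ^ (p - 1 - k) ∈ augIdealLie A ^ (3 * p) := by
    rw [hP] at m1
    exact (Submodule.add_mem_iff_right _ m2).1 m1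
  rw [dimensionSubring, Set.mem_ofPred_eq]
  convert m3 using 1
  have h1 : ∀ n, UniversalEnvelopingAlgebra.ι ℤ ((fun y => ⁅z, y⁆)^[n] x) = (fun y => Z * y - y * Z)^[n] X := by
    intro n
    induction n with
    | zero => rfl
    | succ n ih => rw [Function.iterate_succ_apply', Function.iterate_succ_apply', iota_lie, ih]
  rw [map_zsmul, h1, ad_aux, Nat.sub_add_cancel hp1.le, ← zsmul_eq_mul, Finset.smul_sum]
  rw [← Finset.sum_range_reflect (fun k => Z ^ k * X * Z ^ (p - 1 - k)), Finset.smul_sum]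
  apply Finset.sum_congr rfl
  intro k hk
  rw [Finset.mem_range] at hk
  obtain ⟨d, hd⟩ := choose_aux p hp k hk
  have e : p - 1 - (p - 1 - k) = k := by omega
  have hc : (-1 : ℤ) ^ k * ((p - 1).choose k : ℤ) = 1 + p * ((-1) ^ k * d) := by
    have : ((p - 1).choose k : ℤ) = (-1) ^ k + p * d := by linarith
    rw [this, mul_add, ← mul_pow]
    norm_num
    ring
  rw [e, hc, smul_smul, pow_succ, mul_add, mul_one, add_smul]
  have hz0 : ((p : ℤ) ^ (2 * p) * p * (p * ((-1) ^ k * d))) • (Z ^ (p - 1 - k) * X * Z ^ k) = 0 := by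
    have h0 : ((p : ℤ) ^ (2 * p) * p * p) • X = 0 := by rw [zsmul_eq_mul, hX0]
    rw [← mul_assoc, mul_comm, mul_smul, ← smul_mul_assoc, ← mul_smul_comm _ (Z ^ (p - 1 - k)) X, h0]
    simp
  rw [hz0, add_zero]

end UPart
section Ext

/-- The extension of a Lie ring by a derivation. -/
structure DExt (L : Type) [LieRing L] (D : L →+ L) : Type where
  fst : ℤ
  snd : L

namespace DExt

variable {L : Type} [LieRing L] {D : L →+ L}

theorem ext' {a b : DExt L D} (h1 : a.fst = b.fst) (h2 : a.snd = b.snd) : a = b := by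
  cases a; cases b; simp_all

instance : Zero (DExt L D) := ⟨⟨0, 0⟩⟩
instance : Add (DExt L D) := ⟨fun a b => ⟨a.fst + b.fst, a.snd + b.snd⟩⟩
instance : Neg (DExt L D) := ⟨fun a => ⟨-a.fst, -a.snd⟩⟩

theorem zero_fst : (0 : DExt L D).fst = 0 := rfl
theorem zero_snd : (0 : DExt L D).snd = 0 := rfl
theorem add_fst (a b : DExt L D) : (a + b).fst = a.fst + b.fst := rfl
theorem add_snd (a b : DExt L D) : (a + b).snd = a.snd + b.snd := rfl
theorem neg_fst (a : DExt L D) : (-a).fst = -a.fst := rfl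
theorem neg_snd (a : DExt L D) : (-a).snd = -a.snd := rfl

instance : AddCommGroup (DExt L D) where
  add_assoc a b c := ext' (add_assoc _ _ _) (add_assoc _ _ _)
  zero_add a := ext' (zero_add _) (zero_add _)
  add_zero a := ext' (add_zero _) (add_zero _)
  nsmul := nsmulRec
  zsmul := zsmulRec
  neg_add_cancel a := ext' (neg_add_cancel _) (neg_add_cancel _)
  add_comm a b := ext' (add_comm _ _) (add_comm _ _)

instance : Bracket (DExt L D) (DExt L D) :=
  ⟨fun a b => ⟨0, a.fst • D b.snd - b.fst • D a.snd + ⁅a.snd, b.snd⁆⟩⟩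

theorem lie_fst (a b : DExt L D) : ⁅a, b⁆.fst = 0 := rfl
theorem lie_snd (a b : DExt L D) :
    ⁅a, b⁆.snd = a.fst • D b.snd - b.fst • D a.snd + ⁅a.snd, b.snd⁆ := rfl

/-- Lie ring structure. -/
abbrev lieRing (hD : ∀ a b : L, D ⁅a, b⁆ = ⁅D a, b⁆ + ⁅a, D b⁆) : LieRing (DExt L D) where
  add_lie a b c := by
    apply ext'
    · simp only [lie_fst, add_fst, add_zero]
    · simp only [lie_snd, add_fst, add_snd, add_lie, map_add, add_smul, smul_add]
      abel
  lie_add a b c := by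
    apply ext'
    · simp only [lie_fst, add_fst, add_zero]
    · simp only [lie_snd, add_fst, add_snd, lie_add, map_add, add_smul, smul_add]
      abel
  lie_self a := by
    apply ext'
    · rfl
    · simp only [lie_snd, lie_self, sub_self, add_zero, zero_snd]
  leibniz_lie a b c := by
    apply ext'
    · simp only [lie_fst, add_fst, add_zero]
    · simp only [lie_snd, lie_fst, add_snd, lie_add, lie_sub, sub_lie, add_lie, map_add, map_sub, map_zsmul,
        lie_zsmul, zsmul_lie, smul_add, smul_sub, zero_smul, hD]
      rw [leibniz_lie a.snd b.snd c.snd]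
      have e1 : a.fst • b.fst • D (D c.snd) = b.fst • a.fst • D (D c.snd) := smul_comm _ _ _
      have e2 : a.fst • c.fst • D (D b.snd) = c.fst • a.fst • D (D b.snd) := smul_comm _ _ _
      have e3 : b.fst • c.fst • D (D a.snd) = c.fst • b.fst • D (D a.snd) := smul_comm _ _ _
      have e4 : ⁅b.snd, D a.snd⁆ = - ⁅D a.snd, b.snd⁆ := (lie_skew _ _).symm
      rw [e1, e2, e3, e4]
      simp only [smul_neg]
      abel

end DExt

end Ext
section Filt

variable {L : Type} [LieRing L] {D : L →+ L}

/-- The subring `ℤ ⋉ W 1` of the extension. -/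
def filtSub (hD : ∀ a b : L, D ⁅a, b⁆ = ⁅D a, b⁆ + ⁅a, D b⁆) (W : ℕ → AddSubgroup L)
    (hanti : ∀ k, W (k + 1) ≤ W k)
    (hlie : ∀ k l a b, 1 ≤ k → 1 ≤ l → a ∈ W k → b ∈ W l → ⁅a, b⁆ ∈ W (k + l))
    (hDW : ∀ k a, 1 ≤ k → a ∈ W k → D a ∈ W (k + 1)) :
    letI := DExt.lieRing hD
    LieSubalgebra ℤ (DExt L D) :=
  letI := DExt.lieRing hD
  { AddSubgroup.toIntSubmodule
      ({ carrier := {a | a.snd ∈ W 1}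
         zero_mem' := (W 1).zero_mem
         add_mem' := fun ha hb => (W 1).add_mem ha hb
         neg_mem' := fun ha => (W 1).neg_mem ha } : AddSubgroup (DExt L D)) with
    lie_mem' := by
      intro a b ha hb
      change a.fst • D b.snd - b.fst • D a.snd + ⁅a.snd, b.snd⁆ ∈ W 1
      refine add_mem (sub_mem (zsmul_mem ?_ _) (zsmul_mem ?_ _)) ?_
      · exact hanti 1 (hDW 1 _ le_rfl hb)
      · exact hanti 1 (hDW 1 _ le_rfl ha)
      · exact hanti 1 (hlie 1 1 _ _ le_rfl le_rfl ha hb) }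

/-- The result of the construction, in usable form. -/
theorem filt_exists (hD : ∀ a b : L, D ⁅a, b⁆ = ⁅D a, b⁆ + ⁅a, D b⁆) (W : ℕ → AddSubgroup L)
    (hanti : ∀ k, W (k + 1) ≤ W k)
    (hlie : ∀ k l a b, 1 ≤ k → 1 ≤ l → a ∈ W k → b ∈ W l → ⁅a, b⁆ ∈ W (k + l))
    (hDW : ∀ k a, 1 ≤ k → a ∈ W k → D a ∈ W (k + 1)) :
    ∃ (A : Type) (_ : LieRing A) (f : W 1 →+ A) (τ : A) (g : A → L),
      (∀ a b c : W 1, (c : L) = ⁅(a : L), (b : L)⁆ → f c = ⁅f a, f b⁆) ∧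
      (∀ a b : W 1, (b : L) = D a → f b = ⁅τ, f a⁆) ∧
      (∀ a, g (f a) = a) ∧
      (∀ k a, a ∈ LieModule.lowerCentralSeries ℤ A A k → g a ∈ W (k + 1)) := by
  let _ := DExt.lieRing hD
  let K := filtSub hD W hanti hlie hDW
  refine ⟨K, inferInstance, ⟨⟨fun a => ⟨⟨0, a⟩, a.2⟩, rfl⟩, ?_⟩, ⟨⟨1, 0⟩, (W 1).zero_mem⟩, fun a => a.1.snd, ?_, ?_, ?_, ?_⟩
  · intro a b
    apply Subtype.ext
    exact DExt.ext' (add_zero _).symm rfl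
  · intro a b c h
    apply Subtype.ext
    refine DExt.ext' rfl ?_
    change (c : L) = (0 : ℤ) • D b - (0 : ℤ) • D a + ⁅(a : L), (b : L)⁆
    simp [h]
  · intro a b h
    apply Subtype.ext
    refine DExt.ext' rfl ?_
    change (b : L) = (1 : ℤ) • D a - (0 : ℤ) • D 0 + ⁅(0 : L), (a : L)⁆
    simp [h]
  · intro a; rfl
  · intro k a ha
    refine (lcs_induct (A := K) (fun k a => a.1.snd ∈ W (k + 1) ∧ (1 ≤ k → a.1.fst = 0)) ?_ ?_ ?_ ?_ ?_ k a ha).1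
    · intro a; exact ⟨a.2, by omega⟩
    · intro k; exact ⟨(W _).zero_mem, fun _ => rfl⟩
    · intro k a b ha hb
      refine ⟨(W _).add_mem ha.1 hb.1, fun h => ?_⟩
      change a.1.fst + b.1.fst = 0
      rw [ha.2 h, hb.2 h, add_zero]
    · intro k a ha
      refine ⟨(W _).neg_mem ha.1, fun h => ?_⟩
      change - a.1.fst = 0
      rw [ha.2 h, neg_zero]
    · intro k a b _ hb
      refine ⟨?_, fun _ => rfl⟩
      change a.1.fst • D b.1.snd - b.1.fst • D a.1.snd + ⁅a.1.snd, b.1.snd⁆ ∈ W (k + 1 + 1)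
      have ha : a.1.snd ∈ W 1 := a.2
      refine add_mem (sub_mem (zsmul_mem ?_ _) ?_) ?_
      · exact hDW _ _ (by omega) hb.1
      · rcases Nat.eq_zero_or_pos k with rfl | hk
        · exact zsmul_mem (hDW _ _ le_rfl ha) _
        · rw [hb.2 hk, zero_smul]; exact zero_mem _
      · rw [add_comm (k + 1) 1]
        exact hlie _ _ _ _ le_rfl (by omega) ha hb.1

end Filt
section Realize

open TensorProduct

theorem der_prod {C : Type} [CommRing C] (d : C →ₗ[ℤ] C) (leib : ∀ a b, d (a * b) = d a * b + a * d b) :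
    ∀ n i j : ℕ, i + j = n → ∀ a b : C, d^[i + 1] a = 0 → d^[j + 1] b = 0 → d^[i + j + 1] (a * b) = 0 := by
  have hz : ∀ m, d^[m] (0 : C) = 0 := fun m => Function.iterate_fixed (map_zero d) m
  have hadd : ∀ m (a b : C), d^[m] (a + b) = d^[m] a + d^[m] b := by
    intro m
    induction m with
    | zero => intro a b; rfl
    | succ m ih => intro a b; simp only [Function.iterate_succ_apply, map_add, ih]
  intro n
  induction n with
  | zero =>
    intro i j h a b ha hb
    obtain ⟨rfl, rfl⟩ : i = 0 ∧ j = 0 := by omega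
    simp only [zero_add, Function.iterate_one] at *
    rw [leib, ha, hb]; simp
  | succ n ih =>
    intro i j h a b ha hb
    rw [Function.iterate_succ_apply, leib, hadd]
    have h1 : d^[i + j] (d a * b) = 0 := by
      cases i with
      | zero =>
        simp only [zero_add, Function.iterate_one] at ha
        rw [ha, zero_mul, hz]
      | succ i =>
        rw [Function.iterate_succ_apply] at ha
        rw [show i + 1 + j = i + j + 1 by omega]
        exact ih i j (by omega) _ _ ha hb
    have h2 : d^[i + j] (a * d b) = 0 := by
      cases j with
      | zero =>
        simp only [zero_add, Function.iterate_one] at hb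
        rw [hb, mul_zero, hz]
      | succ j =>
        rw [Function.iterate_succ_apply] at hb
        exact ih i j (by omega) _ _ ha hb
    rw [h1, h2, add_zero]

theorem realize_aux {C : Type} [CommRing C] (d : C →ₗ[ℤ] C)
    (leib : ∀ a b, d (a * b) = d a * b + a * d b)
    (s : ℕ → C) (hs0 : s 0 = 1) (hds0 : d (s 0) = 0) (hds : ∀ j, d (s (j + 1)) = s j)
    (ε : C →ₗ[ℤ] ℤ) (hε : ε 1 = 1)
    {B : Type} [LieRing B] (F : ℕ → AddSubgroup B) (hF1 : F 1 = ⊤)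
    (hF : ∀ i j a b, 1 ≤ i → 1 ≤ j → a ∈ F i → b ∈ F j → ⁅a, b⁆ ∈ F (i + j)) :
    ∃ (A : Type) (_ : LieRing A) (f : B →+ A),
      (∀ a b, f ⁅a, b⁆ = ⁅f a, f b⁆) ∧
      (∀ i b, b ∈ F (i + 1) → f b ∈ LieModule.lowerCentralSeries ℤ A A i) ∧
      (∀ k, (∀ i, k + 1 ≤ i → F i = ⊥) → ∀ b,
        f b ∈ LieModule.lowerCentralSeries ℤ A A k → b = 0) := by
  let D : C ⊗[ℤ] B →+ C ⊗[ℤ] B := (LinearMap.rTensor B d).toAddMonoidHom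
  have hDt : ∀ c b, D (c ⊗ₜ[ℤ] b) = d c ⊗ₜ b := fun c b => rfl
  have lad : ∀ a b c : C ⊗[ℤ] B, ⁅a, b + c⁆ = ⁅a, b⁆ + ⁅a, c⁆ := fun a b c => LieRing.lie_add a b c
  have lze : ∀ a : C ⊗[ℤ] B, ⁅a, (0 : C ⊗[ℤ] B)⁆ = 0 := fun a => by
    have := lad a 0 0
    rw [add_zero] at this
    exact left_eq_add.1 this
  have lne : ∀ a b : C ⊗[ℤ] B, ⁅a, -b⁆ = -⁅a, b⁆ := fun a b => by
    have := lad a b (-b)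
    rw [add_neg_cancel, lze] at this
    exact (neg_eq_of_add_eq_zero_right this.symm).symm
  have hD : ∀ a b : C ⊗[ℤ] B, D ⁅a, b⁆ = ⁅D a, b⁆ + ⁅a, D b⁆ := by
    intro a b
    induction a using TensorProduct.induction_on with
    | zero => simp
    | add a a' h h' => simp only [add_lie, map_add, h, h']; abel
    | tmul c x =>
      induction b using TensorProduct.induction_on with
      | zero => simp only [map_zero, lze, add_zero]
      | add a a' h h' => simp only [lad, map_add, h, h']; abel
      | tmul c' x' =>
        simp only [hDt, LieAlgebra.ExtendScalars.bracket_tmul, leib, TensorProduct.add_tmul]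
  let W : ℕ → AddSubgroup (C ⊗[ℤ] B) := fun k =>
    AddSubgroup.closure {w | ∃ j i c b, d^[j + 1] c = 0 ∧ b ∈ F i ∧ j + k ≤ i ∧ w = c ⊗ₜ b}
  have hWmem : ∀ k j i c b, d^[j + 1] c = 0 → b ∈ F i → j + k ≤ i → c ⊗ₜ[ℤ] b ∈ W k :=
    fun k j i c b h1 h2 h3 => AddSubgroup.subset_closure ⟨j, i, c, b, h1, h2, h3, rfl⟩
  have hanti : ∀ k, W (k + 1) ≤ W k := by
    intro k
    rw [AddSubgroup.closure_le]
    rintro _ ⟨j, i, c, b, h1, h2, h3, rfl⟩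
    exact hWmem k j i c b h1 h2 (by omega)
  have hlie : ∀ k l a b, 1 ≤ k → 1 ≤ l → a ∈ W k → b ∈ W l → ⁅a, b⁆ ∈ W (k + l) := by
    intro k l a b hk hl ha hb
    induction ha using AddSubgroup.closure_induction with
    | zero => simp
    | add x y _ _ hx hy => rw [add_lie]; exact add_mem hx hy
    | neg x _ hx => rw [neg_lie]; exact neg_mem hx
    | mem x hx =>
      obtain ⟨j, i, c, b', h1, h2, h3, rfl⟩ := hx
      induction hb using AddSubgroup.closure_induction with
      | zero => rw [lze]; exact zero_mem _
      | add x y _ _ hx hy => rw [lad]; exact add_mem hx hy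
      | neg x _ hx => rw [lne]; exact neg_mem hx
      | mem x hx =>
        obtain ⟨j', i', c', b'', h1', h2', h3', rfl⟩ := hx
        rw [LieAlgebra.ExtendScalars.bracket_tmul]
        exact hWmem _ (j + j') (i + i') _ _ (der_prod d leib _ _ _ rfl _ _ h1 h1')
          (hF _ _ _ _ (by omega) (by omega) h2 h2') (by omega)
  have hDW : ∀ k a, 1 ≤ k → a ∈ W k → D a ∈ W (k + 1) := by
    intro k a hk ha
    induction ha using AddSubgroup.closure_induction with
    | zero => simp
    | add x y _ _ hx hy => rw [map_add]; exact add_mem hx hy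
    | neg x _ hx => rw [map_neg]; exact neg_mem hx
    | mem x hx =>
      obtain ⟨j, i, c, b, h1, h2, h3, rfl⟩ := hx
      rw [hDt]
      cases j with
      | zero =>
        simp only [zero_add, Function.iterate_one] at h1
        rw [h1, TensorProduct.zero_tmul]; exact zero_mem _
      | succ j =>
        rw [Function.iterate_succ_apply] at h1
        exact hWmem _ j i _ _ h1 h2 (by omega)
  have hs : ∀ j, d^[j + 1] (s j) = 0 := by
    intro j
    induction j with
    | zero => simpa using hds0
    | succ j ih => rw [Function.iterate_succ_apply, hds, ih]
  obtain ⟨A, iA, f, τ, g, hf1, hf2, hf3, hf4⟩ := filt_exists hD W hanti hlie hDW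
  have h1W : ∀ b, (1 : C) ⊗ₜ[ℤ] b ∈ W 1 := by
    intro b
    exact hWmem 1 0 1 _ _ (by simpa [hs0] using hds0) (by rw [hF1]; trivial) (by omega)
  let f' : B →+ A := AddMonoidHom.mk' (fun b => f ⟨(1 : C) ⊗ₜ b, h1W b⟩) (by
      intro a b
      rw [← map_add]
      apply congrArg f
      apply Subtype.ext
      simp [TensorProduct.tmul_add])
  refine ⟨A, iA, f', ?_, ?_, ?_⟩
  · intro a b
    apply hf1
    simp [LieAlgebra.ExtendScalars.bracket_tmul]
  · intro i b hb
    have key : ∀ m n, (h : m + n = i) → ∃ h : s n ⊗ₜ[ℤ] b ∈ W 1,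
        f ⟨s n ⊗ₜ b, h⟩ ∈ LieModule.lowerCentralSeries ℤ A A m := by
      intro m
      induction m with
      | zero =>
        intro n h
        exact ⟨hWmem _ n (i + 1) _ _ (hs n) hb (by omega), by simp⟩
      | succ m ih =>
        intro n h
        obtain ⟨h1, h2⟩ := ih (n + 1) (by omega)
        have h3 : s n ⊗ₜ[ℤ] b ∈ W 1 := hWmem _ n (i + 1) _ _ (hs n) hb (by omega)
        refine ⟨h3, ?_⟩
        rw [hf2 ⟨_, h1⟩ ⟨_, h3⟩ (by simp only [hDt, hds]), LieModule.lowerCentralSeries_succ]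
        exact LieSubmodule.lie_mem_lie (by trivial) h2
    obtain ⟨h1, h2⟩ := key i 0 (by omega)
    have : f' b = f ⟨s 0 ⊗ₜ b, h1⟩ := by
      change f _ = f _
      congr 1; apply Subtype.ext; simp [hs0]
    rw [this]; exact h2
  · intro k hk b hb
    have h1 := hf4 _ _ hb
    have h2 : W (k + 1) = ⊥ := by
      rw [eq_bot_iff, AddSubgroup.closure_le]
      rintro _ ⟨j, i, c, b, h1, h2, h3, rfl⟩
      rw [hk i (by omega), AddSubgroup.mem_bot] at h2
      simp [h2]
    have h3 : g (f' b) = (1 : C) ⊗ₜ[ℤ] b := hf3 _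
    rw [h3, h2, AddSubgroup.mem_bot] at h1
    have h4 := congrArg (fun w => TensorProduct.lid ℤ B (LinearMap.rTensor B ε w)) h1
    simpa [hε] using h4

theorem realize {B : Type} [LieRing B] (F : ℕ → AddSubgroup B) (hF1 : F 1 = ⊤)
    (hF : ∀ i j a b, 1 ≤ i → 1 ≤ j → a ∈ F i → b ∈ F j → ⁅a, b⁆ ∈ F (i + j)) :
    ∃ (A : Type) (_ : LieRing A) (f : B →+ A),
      (∀ a b, f ⁅a, b⁆ = ⁅f a, f b⁆) ∧
      (∀ i b, b ∈ F (i + 1) → f b ∈ LieModule.lowerCentralSeries ℤ A A i) ∧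
      (∀ k, (∀ i, k + 1 ≤ i → F i = ⊥) → ∀ b,
        f b ∈ LieModule.lowerCentralSeries ℤ A A k → b = 0) := by
  let s : ℕ → MvPolynomial ℕ ℤ := fun n => Nat.casesOn n 1 (fun j => MvPolynomial.X j)
  let d := MvPolynomial.mkDerivation ℤ s
  refine realize_aux (C := MvPolynomial ℕ ℤ) d.toLinearMap ?_ s rfl ?_ ?_
    (MvPolynomial.constantCoeff (R := ℤ) (σ := ℕ)).toAddMonoidHom.toIntLinearMap ?_ F hF1 hF
  · intro a b
    change d (a * b) = d a * b + a * d b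
    rw [d.leibniz, smul_eq_mul, smul_eq_mul]; ring
  · change d 1 = 0
    exact d.map_one_eq_zero
  · intro j
    exact MvPolynomial.mkDerivation_X ℤ s j
  · change MvPolynomial.constantCoeff (1 : MvPolynomial ℕ ℤ) = 1
    simp

end Realize
section Concrete

theorem DExt.zsmul_eq {L : Type} [LieRing L] {D : L →+ L} (n : ℤ) (a : DExt L D) :
    n • a = ⟨n * a.fst, n • a.snd⟩ := by
  let f1 : DExt L D →+ ℤ := AddMonoidHom.mk' DExt.fst (fun _ _ => rfl)
  let f2 : DExt L D →+ L := AddMonoidHom.mk' DExt.snd (fun _ _ => rfl)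
  apply DExt.ext'
  · have := map_zsmul f1 n a
    rw [smul_eq_mul] at this
    exact this
  · exact map_zsmul f2 n a

/-- A type carrying the abelian Lie ring `ℕ → ZMod n`. -/
def AbSeq (n : ℕ) : Type := ℕ → ZMod n

instance (n : ℕ) : AddCommGroup (AbSeq n) := inferInstanceAs (AddCommGroup (ℕ → ZMod n))

instance (n : ℕ) : LieRing (AbSeq n) where
  bracket _ _ := 0
  add_lie _ _ _ := (add_zero _).symm
  lie_add _ _ _ := (add_zero _).symm
  lie_self _ := rfl
  leibniz_lie _ _ _ := (add_zero _).symm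

namespace AbSeq

variable {n : ℕ}

theorem lie_eq (a b : AbSeq n) : ⁅a, b⁆ = 0 := rfl
theorem add_ap (a b : AbSeq n) (k : ℕ) : (a + b) k = a k + b k := rfl
theorem sub_ap (a b : AbSeq n) (k : ℕ) : (a - b) k = a k - b k := rfl
theorem neg_ap (a : AbSeq n) (k : ℕ) : (-a) k = - a k := rfl
theorem zero_ap (k : ℕ) : (0 : AbSeq n) k = 0 := rfl
theorem zsmul_ap (m : ℤ) (a : AbSeq n) (k : ℕ) : (m • a) k = (m : ZMod n) * a k := by
  let f : AbSeq n →+ ZMod n := AddMonoidHom.mk' (fun g => g k) (fun _ _ => rfl)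
  have := map_zsmul f m a
  rw [zsmul_eq_mul] at this
  exact this

/-- basis sequence -/
def e (n j : ℕ) : AbSeq n := fun k => if k = j then 1 else 0

/-- truncated shift -/
def T (n p : ℕ) : AbSeq n →+ AbSeq n :=
  AddMonoidHom.mk' (fun g k => if 0 < k ∧ k < p then g (k - 1) else 0) (by
    intro a b
    funext k
    change (if 0 < k ∧ k < p then a (k - 1) + b (k - 1) else 0) =
      (if 0 < k ∧ k < p then a (k - 1) else 0) + (if 0 < k ∧ k < p then b (k - 1) else 0)
    by_cases h : 0 < k ∧ k < p
    · simp only [if_pos h]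
    · simp only [if_neg h, add_zero])

theorem T_ap (p : ℕ) (g : AbSeq n) (k : ℕ) :
    T n p g k = if 0 < k ∧ k < p then g (k - 1) else 0 := rfl

theorem T_e (p j : ℕ) (h : j + 1 < p) : T n p (e n j) = e n (j + 1) := by
  funext k
  rw [T_ap, e, e]
  by_cases hk : k = j + 1
  · subst hk; simp [h]
  · rw [if_neg hk]
    split_ifs with h1 h2
    · omega
    · rfl
    · rfl

theorem T_der (p : ℕ) (a b : AbSeq n) : T n p ⁅a, b⁆ = ⁅T n p a, b⁆ + ⁅a, T n p b⁆ := by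
  simp only [lie_eq, map_zero, add_zero]

/-- The filtration on the abelian ideal. -/
def V (n p i : ℕ) : AddSubgroup (AbSeq n) where
  carrier := {g | ∀ k, (2 ≤ i → p ≤ k → g k = 0) ∧ (2 * k + 1 < i → (p : ZMod n) ^ 2 ∣ g k) ∧
    (3 * k + 2 < i → (p : ZMod n) ^ (2 * p) ∣ g k) ∧ (2 * k + 1 + p < i → g k = 0)}
  zero_mem' := fun k => by simp [zero_ap]
  add_mem' := fun {a b} ha hb k => by
    obtain ⟨a1, a2, a3, a4⟩ := ha k
    obtain ⟨b1, b2, b3, b4⟩ := hb k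
    rw [add_ap]
    exact ⟨fun h h' => by rw [a1 h h', b1 h h', add_zero], fun h => dvd_add (a2 h) (b2 h),
      fun h => dvd_add (a3 h) (b3 h), fun h => by rw [a4 h, b4 h, add_zero]⟩
  neg_mem' := fun {a} ha k => by
    obtain ⟨a1, a2, a3, a4⟩ := ha k
    rw [neg_ap]
    exact ⟨fun h h' => by rw [a1 h h', neg_zero], fun h => (dvd_neg).2 (a2 h),
      fun h => (dvd_neg).2 (a3 h), fun h => by rw [a4 h, neg_zero]⟩

theorem mem_V {n p i : ℕ} {g : AbSeq n} : g ∈ V n p i ↔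
    ∀ k, (2 ≤ i → p ≤ k → g k = 0) ∧ (2 * k + 1 < i → (p : ZMod n) ^ 2 ∣ g k) ∧
    (3 * k + 2 < i → (p : ZMod n) ^ (2 * p) ∣ g k) ∧ (2 * k + 1 + p < i → g k = 0) := Iff.rfl

/-- The condition on the first coordinate (after removing the exceptional part). -/
def aCond (p i : ℕ) (a : ℤ) : Prop := (2 < i → (p : ℤ) ^ (2 * p) ∣ a) ∧ (p + 2 < i → a = 0)

theorem half1 {n p i j : ℕ} (hn : n = p ^ (2 * p + 2)) (hi : 1 ≤ i) (hj : 1 ≤ j)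
    {a : ℤ} (ha : aCond p i a) {g : AbSeq n} (hg : g ∈ V n p j) :
    a • T n p g ∈ V n p (i + j) := by
  have hp0 : (p : ZMod n) ^ (2 * p) * (p : ZMod n) ^ 2 = 0 := by
    rw [← pow_add]; subst hn; exact_mod_cast ZMod.natCast_self (p ^ (2 * p + 2))
  rw [mem_V]
  intro k
  rw [zsmul_ap, T_ap]
  by_cases hk : 0 < k ∧ k < p
  swap
  · simp [if_neg hk]
  rw [if_pos hk]
  obtain ⟨b1, b2, b3, b4⟩ := hg (k - 1)
  rcases Nat.lt_or_ge 2 i with h | h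
  · obtain ⟨c, hc⟩ := ha.1 h
    have hd : (p : ZMod n) ^ (2 * p) ∣ (a : ZMod n) := ⟨c, by rw [hc]; push_cast; rfl⟩
    refine ⟨fun _ _ => by omega, fun _ => ?_, fun _ => ?_, fun h' => ?_⟩
    · exact Dvd.dvd.mul_right ((pow_dvd_pow _ (by omega)).trans hd) _
    · exact Dvd.dvd.mul_right hd _
    · rcases Nat.lt_or_ge (p + 2) i with h2 | h2
      · rw [ha.2 h2]; simp
      · have := mul_dvd_mul hd (b2 (by omega))
        rw [hp0] at this
        exact zero_dvd_iff.1 this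
  · refine ⟨fun _ _ => by omega, fun _ => ?_, fun _ => ?_, fun h' => ?_⟩
    · exact Dvd.dvd.mul_left (b2 (by omega)) _
    · exact Dvd.dvd.mul_left (b3 (by omega)) _
    · rw [b4 (by omega), mul_zero]

theorem half2 {n p i j : ℕ} (hn : n = p ^ (2 * p + 2)) (hp : 1 < p) (hi : 1 ≤ i) (hj : 1 ≤ j)
    {β : ℤ} (hβ : 3 < i → β = 0) {g : AbSeq n} (hg : g ∈ V n p j) :
    ((p : ℤ) ^ 2 * β) • T n p g ∈ V n p (i + j) := by
  have hp0 : (p : ZMod n) ^ (2 * p) * (p : ZMod n) ^ 2 = 0 := by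
    rw [← pow_add]; subst hn; exact_mod_cast ZMod.natCast_self (p ^ (2 * p + 2))
  rcases Nat.lt_or_ge 3 i with h | h
  · rw [hβ h]; simp
  rw [mem_V]
  intro k
  rw [zsmul_ap, T_ap]
  by_cases hk : 0 < k ∧ k < p
  swap
  · simp [if_neg hk]
  rw [if_pos hk]
  obtain ⟨b1, b2, b3, b4⟩ := hg (k - 1)
  have hd : (p : ZMod n) ^ 2 ∣ (((p : ℤ) ^ 2 * β : ℤ) : ZMod n) := ⟨β, by push_cast; rfl⟩
  refine ⟨fun _ _ => by omega, fun _ => ?_, fun _ => ?_, fun h' => ?_⟩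
  · exact Dvd.dvd.mul_right hd _
  · exact Dvd.dvd.mul_left (b3 (by omega)) _
  · have := mul_dvd_mul hd (b3 (by omega))
    rw [mul_comm ((p : ZMod n) ^ 2), hp0] at this
    exact zero_dvd_iff.1 this

theorem half3 {n p i j : ℕ} (hn : n = p ^ (2 * p + 2)) (hp : 1 < p) (hi : 1 ≤ i) (hj : 1 ≤ j)
    {a β : ℤ} (ha : aCond p i a) (hβ : 3 < j → β = 0) :
    ((p : ℤ) ^ 3 * a * β) • e n 1 ∈ V n p (i + j) := by
  have hp0 : (p : ZMod n) ^ (2 * p) * (p : ZMod n) ^ 2 = 0 := by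
    rw [← pow_add]; subst hn; exact_mod_cast ZMod.natCast_self (p ^ (2 * p + 2))
  rcases Nat.lt_or_ge 3 j with h | h
  · rw [hβ h]; simp
  rw [mem_V]
  intro k
  rw [zsmul_ap, e]
  by_cases hk : k = 1
  swap
  · simp [if_neg hk]
  rw [if_pos hk, mul_one]
  rcases Nat.lt_or_ge 2 i with h1 | h1
  · obtain ⟨c, hc⟩ := ha.1 h1
    have : (((p : ℤ) ^ 3 * a * β : ℤ) : ZMod n) = 0 := by
      rw [hc]
      push_cast
      have : (p : ZMod n) ^ 3 * ((p : ZMod n) ^ (2 * p) * c) * β =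
        ((p : ZMod n) ^ (2 * p) * (p : ZMod n) ^ 2) * (p * c * β) := by ring
      rw [this, hp0, zero_mul]
    rw [this]; simp
  · refine ⟨fun _ _ => by omega, fun _ => ?_, fun _ => by omega, fun h' => by omega⟩
    refine ⟨p * a * β, ?_⟩
    push_cast; ring

end AbSeq

open AbSeq

/-- The concrete N-series. -/
def FF (n p i : ℕ) : AddSubgroup (DExt (AbSeq n) (T n p)) where
  carrier := {w | ∃ β : ℤ, (3 < i → β = 0) ∧ w.snd - ((p : ℤ) ^ 3 * β) • e n 0 ∈ V n p i ∧
    aCond p i (w.fst - (p : ℤ) ^ 2 * β)}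
  zero_mem' := ⟨0, fun _ => rfl, by rw [DExt.zero_snd]; simp, by rw [DExt.zero_fst]; simp [aCond]⟩
  add_mem' := by
    rintro a b ⟨β, h1, h2, h3⟩ ⟨β', h1', h2', h3'⟩
    refine ⟨β + β', fun h => by rw [h1 h, h1' h, add_zero], ?_, ?_⟩
    · rw [DExt.add_snd]
      convert add_mem h2 h2' using 1
      rw [mul_add, add_smul]; abel
    · have : (a + b).fst - (p : ℤ) ^ 2 * (β + β') =
        (a.fst - (p : ℤ) ^ 2 * β) + (b.fst - (p : ℤ) ^ 2 * β') := by
        rw [DExt.add_fst]; ring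
      rw [this]
      exact ⟨fun h => dvd_add (h3.1 h) (h3'.1 h), fun h => by rw [h3.2 h, h3'.2 h, add_zero]⟩
  neg_mem' := by
    rintro a ⟨β, h1, h2, h3⟩
    refine ⟨-β, fun h => by rw [h1 h, neg_zero], ?_, ?_⟩
    · rw [DExt.neg_snd]
      convert neg_mem h2 using 1
      rw [mul_neg, neg_smul]; abel
    · have : (-a).fst - (p : ℤ) ^ 2 * (-β) = -(a.fst - (p : ℤ) ^ 2 * β) := by
        rw [DExt.neg_fst]; ring
      rw [this]
      exact ⟨fun h => (dvd_neg).2 (h3.1 h), fun h => by rw [h3.2 h, neg_zero]⟩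

theorem mem_FF {n p i : ℕ} {w : DExt (AbSeq n) (T n p)} : w ∈ FF n p i ↔
    ∃ β : ℤ, (3 < i → β = 0) ∧ w.snd - ((p : ℤ) ^ 3 * β) • e n 0 ∈ V n p i ∧
    aCond p i (w.fst - (p : ℤ) ^ 2 * β) := Iff.rfl

theorem FF_lie {n p : ℕ} (hn : n = p ^ (2 * p + 2)) (hp : 1 < p) (i j : ℕ)
    (a b : DExt (AbSeq n) (T n p)) (hi : 1 ≤ i) (hj : 1 ≤ j) (ha : a ∈ FF n p i) (hb : b ∈ FF n p j) :
    ⁅a, b⁆ ∈ FF n p (i + j) := by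
  obtain ⟨β, h1, h2, h3⟩ := ha
  obtain ⟨β', h1', h2', h3'⟩ := hb
  refine ⟨0, fun _ => rfl, ?_, by rw [DExt.lie_fst]; simp [aCond]⟩
  rw [DExt.lie_snd, AbSeq.lie_eq, mul_zero, zero_smul, sub_zero, add_zero]
  have A1 := half1 hn hi hj h3 h2'
  have A2 := half2 hn hp hi hj h1 h2'
  have A3 := half3 hn hp hi hj h3 h1'
  have B1 := half1 hn hj hi h3' h2
  have B2 := half2 hn hp hj hi h1' h2
  have B3 := half3 hn hp hj hi h3' h1
  rw [add_comm j i] at B1 B2 B3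
  have key := sub_mem (add_mem (add_mem A1 A2) A3) (add_mem (add_mem B1 B2) B3)
  convert key using 1
  funext k
  have hT : T n p (e n 0) = e n 1 := T_e p 0 (by omega)
  simp only [map_sub, map_zsmul, hT, AbSeq.sub_ap, AbSeq.add_ap, AbSeq.zsmul_ap]
  push_cast
  ring

theorem FF_one (n p : ℕ) : FF n p 1 = ⊤ := by
  rw [eq_top_iff]
  intro w _
  refine ⟨0, fun _ => rfl, ?_, ⟨fun h => by omega, fun h => by omega⟩⟩
  intro k
  exact ⟨fun h => by omega, fun h => by omega, fun h => by omega, fun h => by omega⟩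

theorem FF_bot {n p : ℕ} (hp : 1 < p) (i : ℕ) (hi : 3 * p ≤ i) : FF n p i = ⊥ := by
  rw [eq_bot_iff]
  rintro w ⟨β, h1, h2, h3⟩
  have hb := h1 (by omega)
  subst hb
  rw [mul_zero, zero_smul, sub_zero] at h2
  have h4 := h3.2 (by omega)
  rw [mul_zero, sub_zero] at h4
  rw [AddSubgroup.mem_bot]
  apply DExt.ext' h4
  funext k
  obtain ⟨b1, b2, b3, b4⟩ := h2 k
  change w.snd k = 0
  by_cases hk : p ≤ k
  · exact b1 (by omega) hk
  · exact b4 (by omega)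

end Concrete
/-- For every prime `p` there exist a Lie ring `A`, an integer `n ≥ 1` and `a ∈ A` with
`a ∈ δ_n(A)`, `a ∉ γ_n(A)` and `p·a ∈ γ_n(A)`: the dimension quotient
`δ_n(A)/γ_n(A)` contains an element of order `p`. -/
theorem lie_dimension_quotient_contains_p_torsion (p : ℕ) (hp : p.Prime) :
    ∃ (A : Type) (_ : LieRing A) (_ : LieAlgebra ℤ A) (n : ℕ) (a : A), 1 ≤ n ∧
      a ∈ dimensionSubring A n ∧ a ∉ gammaLie A n ∧ (p : ℤ) • a ∈ gammaLie A n := by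
  have hp1 := hp.one_lt
  obtain ⟨n, hn⟩ : ∃ n, n = p ^ (2 * p + 2) := ⟨_, rfl⟩
  let _ : LieRing (DExt (AbSeq n) (AbSeq.T n p)) := DExt.lieRing (AbSeq.T_der p)
  obtain ⟨A, iA, f, hf1, hf2, hf3⟩ := realize (FF n p) (FF_one n p) (FF_lie hn hp1)
  let x : DExt (AbSeq n) (AbSeq.T n p) := ⟨0, AbSeq.e n 0⟩
  let z : DExt (AbSeq n) (AbSeq.T n p) := ⟨1, 0⟩
  have hn0 : ((p : ℤ) ^ (2 * p + 2) : ℤ) • AbSeq.e n 0 = 0 := by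
    funext k
    rw [AbSeq.zsmul_ap]
    have : (((p : ℤ) ^ (2 * p + 2) : ℤ) : ZMod n) = 0 := by
      subst hn
      exact_mod_cast ZMod.natCast_self (p ^ (2 * p + 2))
    rw [this, zero_mul]; rfl
  have hx : ((p : ℤ) ^ (2 * p + 2)) • x = 0 := by
    rw [DExt.zsmul_eq]
    exact DExt.ext' (mul_zero _) hn0
  have hz : z ∈ FF n p 2 := by
    refine ⟨0, fun _ => rfl, ?_, ⟨fun h => by omega, fun h => by omega⟩⟩
    change (0 : AbSeq n) - _ ∈ _
    simp
  have hu : ((p : ℤ) ^ 3) • x + ((p : ℤ) ^ 2) • z ∈ FF n p 3 := by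
    rw [DExt.zsmul_eq, DExt.zsmul_eq]
    refine ⟨1, fun h => by omega, ?_, ?_⟩
    · change ((p : ℤ) ^ 3) • AbSeq.e n 0 + ((p : ℤ) ^ 2) • (0 : AbSeq n) - _ ∈ _
      simp
    · change AbSeq.aCond p 3 ((p : ℤ) ^ 3 * 0 + (p : ℤ) ^ 2 * 1 - (p : ℤ) ^ 2 * 1)
      simp [AbSeq.aCond]
  have hv : ((p : ℤ) ^ (2 * p)) • z ∈ FF n p (p + 2) := by
    rw [DExt.zsmul_eq]
    refine ⟨0, fun _ => rfl, ?_, ?_⟩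
    · change ((p : ℤ) ^ (2 * p)) • (0 : AbSeq n) - _ ∈ _
      simp
    · change AbSeq.aCond p (p + 2) ((p : ℤ) ^ (2 * p) * 1 - (p : ℤ) ^ 2 * 0)
      simp [AbSeq.aCond]
  have had : ∀ m, m < p → (fun y => ⁅z, y⁆)^[m] x = ⟨0, AbSeq.e n m⟩ := by
    intro m
    induction m with
    | zero => intro _; rfl
    | succ m ih =>
      intro h
      rw [Function.iterate_succ_apply', ih (by omega)]
      refine DExt.ext' rfl ?_
      change (1 : ℤ) • AbSeq.T n p (AbSeq.e n m) - (0 : ℤ) • AbSeq.T n p 0 + 0 = AbSeq.e n (m + 1)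
      rw [AbSeq.T_e p m h]
      simp
  have hfad : ∀ m, f ((fun y => ⁅z, y⁆)^[m] x) = (fun y => ⁅f z, y⁆)^[m] (f x) := by
    intro m
    induction m with
    | zero => rfl
    | succ m ih => rw [Function.iterate_succ_apply', Function.iterate_succ_apply', hf1, ih]
  have hδ := delta_main p hp (f x) (f z) (by rw [← map_zsmul, hx, map_zero])
    (by rw [← map_zsmul, ← map_zsmul, ← map_add]; exact hf2 2 _ hu) (hf2 1 _ hz)
    (by rw [← map_zsmul]; exact hf2 (p + 1) _ hv)
  rw [← hfad, had (p - 1) (by omega), ← map_zsmul, DExt.zsmul_eq] at hδ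
  refine ⟨A, iA, inferInstance, 3 * p, _, by omega, hδ, ?_, ?_⟩
  · intro h
    have h0 := hf3 (3 * p - 1) (fun i hi => FF_bot hp1 i (by omega)) _ h
    have h1 := congrArg DExt.snd h0
    have h2 := congrFun h1 (p - 1)
    change (((p : ℤ) ^ (2 * p + 1)) • AbSeq.e n (p - 1)) (p - 1) = 0 at h2
    rw [AbSeq.zsmul_ap, AbSeq.e, if_pos rfl, mul_one] at h2
    have h3 : ((p ^ (2 * p + 1) : ℕ) : ZMod n) = 0 := by exact_mod_cast h2
    rw [ZMod.natCast_eq_zero_iff, hn] at h3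
    have := (Nat.pow_dvd_pow_iff_le_right hp1).1 h3
    omega
  · rw [← map_zsmul, DExt.zsmul_eq]
    convert (gammaLie A (3 * p)).zero_mem using 1
    rw [← map_zero f]
    congr 1
    apply DExt.ext'
    · simp [DExt.zero_fst]
    · rw [DExt.zero_snd]
      funext k
      change ((p : ℤ) • ((p : ℤ) ^ (2 * p + 1)) • AbSeq.e n (p - 1)) k = (0 : AbSeq n) k
      rw [AbSeq.zsmul_ap, AbSeq.zsmul_ap, ← mul_assoc, AbSeq.zero_ap]
      have : ((p : ℤ) : ZMod n) * (((p : ℤ) ^ (2 * p + 1) : ℤ) : ZMod n) = 0 := by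
        subst hn
        rw [← Int.cast_mul, ← pow_succ']
        exact_mod_cast ZMod.natCast_self (p ^ (2 * p + 2))
      rw [this, zero_mul]
end
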